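/- Let 𝒜 be a totally sign-skew-symmetric cluster algebra having principal coefficients at t₀, and let x_{l;t} and x_{l';t'} be two non-initial cluster variables of 𝒜 with associated F-polynomials F_{l;t} and F_{l';t'}. If F_{l;t} = F_{l';t'}, then x_{l;t} = x_{l';t'}. -/

import Mathlib

/- Common framework for totally sign-skew-symmetric (TSSS) cluster algebras with
principal coefficients, following Fomin–Zelevinsky and the paper.

We realize the ambient field `ℱ` for a rank-`n` cluster algebra with principal
coefficients at the initial vertex `t₀` as the field of rational functions in the
`2n` variables `x₁,…,xₙ,y₁,…,yₙ`.  Vertices of the `n`-regular tree `𝕋ₙ` are modelled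
as paths (lists of mutation directions) starting from the initial vertex `t₀ = []`. -/

open scoped BigOperators Classical

namespace CA

/-- the positive part `[x]₊ = max(x,0)`. -/
def pp (x : ℤ) : ℤ := max x 0

/-- the modified binomial coefficient `C̃(i,j)`: the binomial coefficient `(i choose j)`
when `i ≥ 0`, and `0` when `i < 0`. -/
def ctilde (i : ℤ) (j : ℕ) : ℤ := if 0 ≤ i then (i.toNat.choose j : ℤ) else 0

/-- the (generalized) binomial coefficient `(i choose j) = i(i-1)⋯(i-j+1)/j!` for `i : ℤ`. -/
def ibinom (i : ℤ) (j : ℕ) : ℤ :=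
  if 0 ≤ i then (i.toNat.choose j : ℤ)
  else (-1 : ℤ) ^ j * ((((j : ℤ) - 1 - i).toNat.choose j : ℤ))

variable {n : ℕ}

/-- matrix mutation of a square `n × n` integer matrix in direction `k`. -/
def matMut (B : Matrix (Fin n) (Fin n) ℤ) (k : Fin n) : Matrix (Fin n) (Fin n) ℤ :=
  Matrix.of fun i j =>
    if i = k ∨ j = k then -B i j else B i j + (B i k).sign * pp (B i k * B k j)

/-- a square integer matrix is sign-skew-symmetric. -/
def SSS (B : Matrix (Fin n) (Fin n) ℤ) : Prop :=
  ∀ i j, (B i j = 0 ∧ B j i = 0) ∨ B i j * B j i < 0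

/-- a square integer matrix is totally sign-skew-symmetric: every iterated mutation of it
is sign-skew-symmetric. -/
def TSSS (B : Matrix (Fin n) (Fin n) ℤ) : Prop :=
  ∀ l : List (Fin n), SSS (l.foldl matMut B)

/-- `d` is a skew-symmetrizer of `B`, i.e. `diag(d) * B` is skew-symmetric with all `dᵢ > 0`;
this says `B` is skew-symmetrizable. -/
def SkewSymmetrizer (d : Fin n → ℤ) (B : Matrix (Fin n) (Fin n) ℤ) : Prop :=
  (∀ i, 0 < d i) ∧ ∀ i j, d i * B i j = -(d j * B j i)

/-- the ambient field ℱ: rational functions in `x₁,…,xₙ` (indexed by `Sum.inl`) and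
`y₁,…,yₙ` (indexed by `Sum.inr`). -/
abbrev K (n : ℕ) := FractionRing (MvPolynomial (Fin n ⊕ Fin n) ℚ)

noncomputable def gen (s : Fin n ⊕ Fin n) : K n :=
  algebraMap (MvPolynomial (Fin n ⊕ Fin n) ℚ) (K n) (MvPolynomial.X s)

/-- the initial cluster variables `x₁,…,xₙ`. -/
noncomputable def xv (i : Fin n) : K n := gen (Sum.inl i)

/-- the initial coefficients `y₁,…,yₙ` (generators of `ℙ = Trop(y₁,…,yₙ)`). -/
noncomputable def yv (i : Fin n) : K n := gen (Sum.inr i)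

/-- the extended `2n × n` exchange matrix `B̃ = (B ; I)` of the principal-coefficients seed. -/
def extB (B : Matrix (Fin n) (Fin n) ℤ) : Matrix (Fin n ⊕ Fin n) (Fin n) ℤ :=
  Matrix.of (Sum.elim B fun i j => if i = j then 1 else 0)

/-- mutation of an extended exchange matrix in direction `k`. -/
def extMut (Bt : Matrix (Fin n ⊕ Fin n) (Fin n) ℤ) (k : Fin n) :
    Matrix (Fin n ⊕ Fin n) (Fin n) ℤ :=
  Matrix.of fun i j =>
    if i = Sum.inl k ∨ j = k then -Bt i j
    else Bt i j + (Bt i k).sign * pp (Bt i k * Bt (Sum.inl k) j)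

/-- the extended exchange matrix at the vertex of `𝕋ₙ` reached from `t₀` along the path `t`. -/
def extBAt (B : Matrix (Fin n) (Fin n) ℤ) (t : List (Fin n)) :
    Matrix (Fin n ⊕ Fin n) (Fin n) ℤ :=
  t.foldl extMut (extB B)

/-- the (square) exchange matrix at the vertex `t`. -/
def sqBAt (B : Matrix (Fin n) (Fin n) ℤ) (t : List (Fin n)) : Matrix (Fin n) (Fin n) ℤ :=
  Matrix.of fun i j => extBAt B t (Sum.inl i) j

/-- a seed (of geometric type, with the frozen variables `y₁,…,yₙ` kept implicit):
the cluster together with the extended exchange matrix. -/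
structure Seed (n : ℕ) where
  x : Fin n → K n
  B : Matrix (Fin n ⊕ Fin n) (Fin n) ℤ

/-- seed mutation in direction `k` (principal coefficients / geometric type). -/
noncomputable def mutSeed (s : Seed n) (k : Fin n) : Seed n where
  x := Function.update s.x k
    (((∏ i, s.x i ^ pp (s.B (Sum.inl i) k)) * (∏ i, yv i ^ pp (s.B (Sum.inr i) k)) +
        (∏ i, s.x i ^ pp (-s.B (Sum.inl i) k)) * (∏ i, yv i ^ pp (-s.B (Sum.inr i) k))) /
      s.x k)
  B := extMut s.B k

/-- the initial seed `Σ_{t₀}` of the cluster algebra with principal coefficients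
with initial exchange matrix `B`. -/
noncomputable def initSeed (B : Matrix (Fin n) (Fin n) ℤ) : Seed n := ⟨xv, extB B⟩

/-- the seed `Σ_t` at the vertex of `𝕋ₙ` reached from `t₀` along the path `t`. -/
noncomputable def seed (B : Matrix (Fin n) (Fin n) ℤ) (t : List (Fin n)) : Seed n :=
  t.foldl mutSeed (initSeed B)

/-- the `Y`-variable `y_{j;t}` (a Laurent monomial in `y₁,…,yₙ` since `ℙ = Trop(Y)`). -/
noncomputable def yvarAt (B : Matrix (Fin n) (Fin n) ℤ) (t : List (Fin n)) (j : Fin n) :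
    K n :=
  ∏ i, yv i ^ extBAt B t (Sum.inr i) j

/-- `ŷ_j = y_j ∏ᵢ xᵢ^{b_{ij}}` at the initial vertex. -/
noncomputable def yhat (B : Matrix (Fin n) (Fin n) ℤ) (j : Fin n) : K n :=
  yv j * ∏ i, xv i ^ B i j

/-- auxiliary one-step recursion computing `g`-vectors along a path. -/
def gMut (B0 : Matrix (Fin n) (Fin n) ℤ)
    (st : Matrix (Fin n ⊕ Fin n) (Fin n) ℤ × (Fin n → Fin n → ℤ)) (k : Fin n) :
    Matrix (Fin n ⊕ Fin n) (Fin n) ℤ × (Fin n → Fin n → ℤ) :=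
  (extMut st.1 k, fun j d =>
    if j = k then
      -st.2 k d + (∑ i, pp (st.1 (Sum.inl i) k) * st.2 i d) -
        ∑ i, pp (st.1 (Sum.inr i) k) * B0 d i
    else st.2 j d)

/-- the `g`-vector `g_{l;t}` of the cluster variable `x_{l;t}` with respect to the initial
seed, via the standard recursion `g_{j;t₀} = e_j`,
`g_{k;t'} = -g_{k;t} + Σᵢ [bᵗ_{ik}]₊ g_{i;t} - Σᵢ [bᵗ_{n+i,k}]₊ b_i^{t₀}`. -/
def gvec (B : Matrix (Fin n) (Fin n) ℤ) (t : List (Fin n)) : Fin n → Fin n → ℤ :=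
  (t.foldl (gMut B) (extB B, fun j d => if d = j then 1 else 0)).2

/-- representations of Laurent polynomials `Σ c_e Y^{e∘inr} X_t^{e∘inl}` at a vertex `t`:
finitely supported integer coefficient functions on exponent vectors. -/
abbrev LP (n : ℕ) := ((Fin n ⊕ Fin n) → ℤ) →₀ ℤ

/-- evaluation of a Laurent-polynomial representation at the vertex `t`:
`e` contributes `c_e · Y_t^{e∘inr} · X_t^{e∘inl}`. -/
noncomputable def evalAt (B : Matrix (Fin n) (Fin n) ℤ) (t : List (Fin n)) (f : LP n) :
    K n :=
  f.sum fun e c =>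
    (c : K n) * (∏ i, yvarAt B t i ^ e (Sum.inr i)) * ∏ i, (seed B t).x i ^ e (Sum.inl i)

/-- the `ℤⁿ`-degree of the monomial with exponent vector `e` at the vertex `t`,
under the grading `deg(x_{i;t}) = eᵢ`, `deg(y_{i;t}) = -bᵢᵗ`. -/
def degVecAt (B : Matrix (Fin n) (Fin n) ℤ) (t : List (Fin n))
    (e : (Fin n ⊕ Fin n) → ℤ) : Fin n → ℤ :=
  fun j => e (Sum.inl j) - ∑ i, e (Sum.inr i) * sqBAt B t j i

/-- homogeneity of degree `h` of a Laurent polynomial at the vertex `t`. -/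
def HomogAt (B : Matrix (Fin n) (Fin n) ℤ) (t : List (Fin n)) (h : Fin n → ℤ)
    (f : LP n) : Prop :=
  ∀ e ∈ f.support, degVecAt B t e = h

/-- `g` is a summand of `f`: for every Laurent monomial, the coefficient in `g` lies
(weakly) between `0` and the coefficient in `f`. -/
def Summand (g f : LP n) : Prop :=
  ∀ e, (0 ≤ g e ∧ g e ≤ f e) ∨ (f e ≤ g e ∧ g e ≤ 0)

/-- the Laurent monomial `X^h` (with trivial coefficient) as a Laurent polynomial. -/
noncomputable def monX (h : Fin n → ℤ) : LP n := Finsupp.single (Sum.elim h 0) 1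

/-- `ℕℙ[X_t^{±1}]`, `ℙ = Trop(y₁,…,yₙ)`: the additive monoid generated by the
Laurent monomials `y^a X_t^b`, `a, b ∈ ℤⁿ`. -/
noncomputable def nnL (s : Seed n) : AddSubmonoid (K n) :=
  AddSubmonoid.closure {m | ∃ a b : Fin n → ℤ, m = (∏ i, yv i ^ a i) * ∏ i, s.x i ^ b i}

/-- `ℤℙ[X_t^{±1}]`: the additive group generated by the Laurent monomials `y^a X_t^b`. -/
noncomputable def zzL (s : Seed n) : AddSubgroup (K n) :=
  AddSubgroup.closure {m | ∃ a b : Fin n → ℤ, m = (∏ i, yv i ^ a i) * ∏ i, s.x i ^ b i}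

/-- `ℕ[Y_t][X_t^{±1}]`: the additive monoid generated by monomials `Y_t^a X_t^b`
with `a ∈ ℕⁿ`, `b ∈ ℤⁿ`. -/
noncomputable def nnYL (B : Matrix (Fin n) (Fin n) ℤ) (t : List (Fin n)) : AddSubmonoid (K n) :=
  AddSubmonoid.closure {m | ∃ (a : Fin n → ℕ) (b : Fin n → ℤ),
    m = (∏ j, yvarAt B t j ^ (a j : ℤ)) * ∏ i, (seed B t).x i ^ b i}

/-- `𝒰_{≥0}(Σ_t) = ℕℙ[X_t^{±1}] ∩ ⋂ᵢ ℕℙ[X_{tᵢ}^{±1}]`, `tᵢ` the neighbours of `t`. -/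
def UgeZero (B : Matrix (Fin n) (Fin n) ℤ) (t : List (Fin n)) : Set (K n) :=
  {v | v ∈ nnL (seed B t) ∧ ∀ k, v ∈ nnL (seed B (t ++ [k]))}

/-- the modification map `L^{t_k}` applied to a homogeneous element of degree `h`
at the vertex `t`: division by `y_{k;t}^{[-h_k]₊}`. -/
noncomputable def Lmap (B : Matrix (Fin n) (Fin n) ℤ) (t : List (Fin n)) (h : Fin n → ℤ)
    (k : Fin n) (v : K n) : K n :=
  v * yvarAt B t k ^ (-pp (-h k))

/-- `𝒰⁺(Σ_t)` for homogeneous elements of degree `h`. -/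
def UPlus (B : Matrix (Fin n) (Fin n) ℤ) (t : List (Fin n)) (h : Fin n → ℤ) :
    Set (K n) :=
  {v | v ∈ UgeZero B t ∧ v ∈ nnYL B t ∧ ∀ k, Lmap B t h k v ∈ nnYL B (t ++ [k])}

/-- `𝒰⁺_{≥0}(Σ_t) = 𝒰⁺(Σ_t) ∩ ⋂ᵢ 𝒰_{≥0}(Σ_{tᵢ})` for homogeneous elements of degree `h`. -/
def UPlusGeZero (B : Matrix (Fin n) (Fin n) ℤ) (t : List (Fin n)) (h : Fin n → ℤ) :
    Set (K n) :=
  {v | v ∈ UPlus B t h ∧ ∀ k, v ∈ UgeZero B (t ++ [k])}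

/-- `𝒰⁺_{≥0}(Σ_t)` (all homogeneous degrees together). -/
def UPGZ (B : Matrix (Fin n) (Fin n) ℤ) (t : List (Fin n)) : Set (K n) :=
  {v | ∃ h, v ∈ UPlusGeZero B t h}

/-- `v` is indecomposable in `S`: it is not a sum of two nonzero elements of `S`. -/
def IndecompIn (S : Set (K n)) (v : K n) : Prop :=
  ¬∃ a b, a ∈ S ∧ b ∈ S ∧ a ≠ 0 ∧ b ≠ 0 ∧ v = a + b

/-- `f` is (a Laurent-polynomial representation at the vertex `t` of) the element
`ρ_h^t`: an indecomposable element of `𝒰⁺_{≥0}(Σ_t)` (homogeneous of degree `h`,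
with nonnegative coefficients) having `X_t^h` as a summand. -/
def IsRhoAt (B : Matrix (Fin n) (Fin n) ℤ) (t : List (Fin n)) (h : Fin n → ℤ)
    (f : LP n) : Prop :=
  HomogAt B t h f ∧ (∀ e, 0 ≤ f e) ∧ Summand (monX h) f ∧
    evalAt B t f ∈ UPlusGeZero B t h ∧ IndecompIn (UPGZ B t) (evalAt B t f)

/-- the exponent vector (at `t₀`) of the Laurent monomial `Ŷ^p X^h`. -/
def hatExp (B : Matrix (Fin n) (Fin n) ℤ) (h p : Fin n → ℤ) : (Fin n ⊕ Fin n) → ℤ :=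
  Sum.elim (fun i => h i + ∑ j, B i j * p j) p

/-- the weight `co_p(N_h)`: the coefficient of `Ŷ^p X^h` in `ρ_h` (equivalently, of `Y^p`
in the `F`-polynomial). -/
def coeffN (B : Matrix (Fin n) (Fin n) ℤ) (h : Fin n → ℤ) (f : LP n) (p : Fin n → ℤ) :
    ℤ :=
  f (hatExp B h p)

def toR (p : Fin n → ℤ) : Fin n → ℝ := fun i => (p i : ℝ)

/-- the Newton polytope `N_h ⊆ ℝⁿ` of `ρ_h` (of the corresponding `F`-polynomial):
the convex hull of the support. -/
def NHull (B : Matrix (Fin n) (Fin n) ℤ) (h : Fin n → ℤ) (f : LP n) :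
    Set (Fin n → ℝ) :=
  convexHull ℝ (toR '' {p | coeffN B h f p ≠ 0})

/-- `S` is a face of the polytope `N`, i.e. the intersection of `N` with a hyperplane
given by a valid inequality. -/
def IsFaceOf (S N : Set (Fin n → ℝ)) : Prop :=
  ∃ (w : Fin n → ℝ) (cst : ℝ), (∀ q ∈ N, ∑ i, w i * q i ≤ cst) ∧
    S = N ∩ {q | ∑ i, w i * q i = cst}

/-- the dimension of a subset of `ℝⁿ` (of its affine hull). -/
noncomputable def dimOf (S : Set (Fin n → ℝ)) : ℕ :=
  Module.finrank ℝ (affineSpan ℝ S).direction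

noncomputable def finsetMinZ (s : Finset ℤ) : ℤ := if h : s.Nonempty then s.min' h else 0

/-- the denominator vector of a Laurent polynomial: `d_k = -min` of the `x_k`-exponents. -/
noncomputable def dvecOf (f : LP n) (k : Fin n) : ℤ :=
  -finsetMinZ (f.support.image fun e => e (Sum.inl k))

/-- `L^{t₀}` applied to (a representation at `t`) of `ρ_h^t`:
`F|_ℱ(Ŷ_t) X_t^h / F|_{Trop(Y_{t₀})}(Y_t)`, the tropical denominator being the
componentwise-minimal `y`-monomial of the support. -/
noncomputable def Lto (B : Matrix (Fin n) (Fin n) ℤ) (t : List (Fin n)) (f : LP n) :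
    K n :=
  evalAt B t f *
    (∏ i, yv i ^
      finsetMinZ (f.support.image fun e => ∑ j, e (Sum.inr j) * extBAt B t (Sum.inr i) j))⁻¹

/-- the set `𝒫 = {L^{t₀}(ρ_h^t) ∈ ℕℙ[X^{±1}] ∣ h ∈ ℤⁿ}` built from the vertex `t`. -/
def PSetAt (B : Matrix (Fin n) (Fin n) ℤ) (t : List (Fin n)) : Set (K n) :=
  {v | (∃ h f, IsRhoAt B t h f ∧ v = Lto B t f) ∧
    v ∈ nnL (seed B ([] : List (Fin n)))}

/-- universal positivity: lying in `ℕℙ[X_t^{±1}]` for every vertex `t`. -/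
def UnivPos (B : Matrix (Fin n) (Fin n) ℤ) (v : K n) : Prop :=
  ∀ t : List (Fin n), v ∈ nnL (seed B t)

/-- universal indecomposability. -/
def UnivIndecomp (B : Matrix (Fin n) (Fin n) ℤ) (v : K n) : Prop :=
  UnivPos B v ∧ ¬∃ a b, UnivPos B a ∧ UnivPos B b ∧ a ≠ 0 ∧ b ≠ 0 ∧ v = a + b

/-- `f` is the Laurent expansion of the cluster variable `x_{l;t}` in the initial cluster. -/
def IsExp (B : Matrix (Fin n) (Fin n) ℤ) (t : List (Fin n)) (l : Fin n) (f : LP n) :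
    Prop :=
  (seed B t).x l = evalAt B ([] : List (Fin n)) f

/-- the `F`-polynomial of a Laurent polynomial: set all `xᵢ = 1`,
i.e. push the coefficients to the `y`-exponents. -/
noncomputable def FPoly (f : LP n) : (Fin n → ℤ) →₀ ℤ :=
  Finsupp.mapDomain (fun e i => e (Sum.inr i)) f

/-- the cluster variable `x_{l;t}` is non-initial. -/
def NonInit (B : Matrix (Fin n) (Fin n) ℤ) (t : List (Fin n)) (l : Fin n) : Prop :=
  ∀ i, (seed B t).x l ≠ xv i

end CA

namespace CAX
open AddMonoidAlgebra

/-- Laurent polynomial ring over the integers. -/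
abbrev R (σ : Type) := AddMonoidAlgebra ℤ (σ → ℤ)

variable {σ : Type}

theorem R_induction {p : R σ → Prop} (f : R σ) (h0 : p 0) (hadd : ∀ f g, p f → p g → p (f + g))
    (hs : ∀ e c, p (single e c)) : p f := by
  have : ∀ q : (σ → ℤ) →₀ ℤ, p (ofCoeff q) := by
    intro q
    induction q using Finsupp.induction_linear with
    | zero => exact h0
    | add f g hf hg => exact hadd _ _ hf hg
    | single a b => exact hs a b
  exact this f.coeff

/-- slices -/
noncomputable def sl (ω : (σ → ℤ) →+ ℤ) (d : ℤ) : R σ →+ R σ where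
  toFun f := ofCoeff (f.coeff.filter (fun e => ω e = d))
  map_zero' := by rw [coeff_zero, Finsupp.filter_zero, ofCoeff_zero]
  map_add' f g := by simp [Finsupp.filter_add]

theorem sl_single (ω : (σ → ℤ) →+ ℤ) (d : ℤ) (e : σ → ℤ) (c : ℤ) :
    sl ω d (single e c) = if ω e = d then single e c else 0 := by
  simp only [sl, AddMonoidHom.coe_mk, ZeroHom.coe_mk, coeff_single]
  split_ifs with h
  · rw [Finsupp.filter_single_of_pos (fun e => ω e = d) h]; rfl
  · rw [Finsupp.filter_single_of_neg (fun e => ω e = d) h]; rfl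

theorem sl_single_mul (ω : (σ → ℤ) →+ ℤ) (d : ℤ) (e : σ → ℤ) (c : ℤ) (f : R σ) :
    sl ω d (single e c * f) = single e c * sl ω (d - ω e) f := by
  induction f using R_induction with
  | h0 => simp
  | hadd f g hf hg => simp [mul_add, hf, hg]
  | hs e' c' =>
    rw [single_mul_single, sl_single, sl_single]
    have : ω (e + e') = d ↔ ω e' = d - ω e := by rw [map_add]; constructor <;> intro h <;> linarith
    simp only [this]
    split_ifs
    · rw [single_mul_single]
    · simp

/-- homogeneous of degree zero -/
def Hom0 (ω : (σ → ℤ) →+ ℤ) (p : R σ) : Prop := ∀ d f, sl ω d (p * f) = p * sl ω d f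

theorem Hom0.single {ω : (σ → ℤ) →+ ℤ} {e : σ → ℤ} (h : ω e = 0) (c : ℤ) :
    Hom0 ω (AddMonoidAlgebra.single e c) := by
  intro d f; rw [sl_single_mul, h, sub_zero]

theorem Hom0.one {ω : (σ → ℤ) →+ ℤ} : Hom0 ω (1 : R σ) := by intro d f; simp

theorem Hom0.add {ω : (σ → ℤ) →+ ℤ} {p q : R σ} (hp : Hom0 ω p) (hq : Hom0 ω q) :
    Hom0 ω (p + q) := by
  intro d f; rw [add_mul, map_add, hp, hq, add_mul]

theorem Hom0.mul {ω : (σ → ℤ) →+ ℤ} {p q : R σ} (hp : Hom0 ω p) (hq : Hom0 ω q) :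
    Hom0 ω (p * q) := by
  intro d f; rw [mul_assoc, hp, hq, mul_assoc]

theorem Hom0.pow {ω : (σ → ℤ) →+ ℤ} {p : R σ} (hp : Hom0 ω p) (n : ℕ) : Hom0 ω (p ^ n) := by
  induction n with
  | zero => simpa using Hom0.one
  | succ n ih => rw [pow_succ]; exact ih.mul hp

/-- bounded -/
theorem exists_bound (ω : (σ → ℤ) →+ ℤ) (f : R σ) :
    ∃ N : ℕ, (∀ d : ℤ, (N : ℤ) < |d| → sl ω d f = 0) ∧
      f = ∑ d ∈ Finset.Icc (-(N : ℤ)) N, sl ω d f := by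
  have h1 : ∃ N : ℕ, (∀ d : ℤ, (N : ℤ) < |d| → sl ω d f = 0) := by
    induction f using R_induction with
    | h0 => exact ⟨0, by simp⟩
    | hadd f g hf hg =>
      obtain ⟨N, hN⟩ := hf
      obtain ⟨M, hM⟩ := hg
      refine ⟨N + M, fun d hd => ?_⟩
      push_cast at hd
      rw [map_add, hN d (by linarith), hM d (by linarith), add_zero]
    | hs e c =>
      refine ⟨(ω e).natAbs, fun d hd => ?_⟩
      rw [sl_single, if_neg]
      rintro rfl
      simp at hd
  obtain ⟨N, hN⟩ := h1
  refine ⟨N, hN, ?_⟩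
  apply coeff_injective
  ext e
  rw [coeff_sum, Finsupp.finsetSum_apply]
  have key : ∀ d, (sl ω d f).coeff e = if ω e = d then f.coeff e else 0 := by
    intro d
    simp [sl, Finsupp.filter_apply]
  simp only [key]
  rw [Finset.sum_ite_eq]
  split_ifs with h
  · rfl
  · have h2 := hN (ω e) (by
      rw [Finset.mem_Icc] at h
      by_contra h3
      push Not at h3
      exact h (abs_le.mp h3))
    have h3 := key (ω e)
    rw [h2] at h3
    simpa using h3.symm

instance : TwoUniqueSums (σ → ℤ) := inferInstance
instance : IsDomain (R σ) := inferInstance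

/-- regular sequence -/
theorem regular (ω : (σ → ℤ) →+ ℤ) (v : σ → ℤ) (hv : ω v = 1) (q : R σ) (hq : Hom0 ω q)
    (g : R σ) (h : q ∣ (1 + single v 1) * g) : q ∣ g := by
  obtain ⟨f, hf⟩ := h
  have h1 : ∀ d, sl ω d g + single v 1 * sl ω (d - 1) g = q * sl ω d f := by
    intro d
    rw [← hq, ← hf, add_mul, one_mul, map_add, sl_single_mul, hv]
  obtain ⟨N, hN, hs⟩ := exists_bound ω g
  have h2 : ∀ m : ℕ, q ∣ sl ω (-(N : ℤ) - 1 + m) g := by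
    intro m
    induction m with
    | zero =>
      rw [hN]
      · exact dvd_zero _
      · rw [lt_abs]; right; push_cast; linarith
    | succ m ih =>
      have h3 := h1 (-(N : ℤ) - 1 + (m + 1 : ℕ))
      have h4 : (-(N : ℤ) - 1 + (m + 1 : ℕ)) - 1 = -(N : ℤ) - 1 + m := by push_cast; ring
      rw [h4] at h3
      rw [eq_sub_of_add_eq h3]
      exact dvd_sub (Dvd.intro _ rfl) (Dvd.dvd.mul_left ih _)
  rw [hs]
  apply Finset.dvd_sum
  intro d hd
  rw [Finset.mem_Icc] at hd
  have h5 := h2 (d + N + 1).toNat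
  rw [Int.toNat_of_nonneg (by linarith)] at h5
  convert h5 using 2
  ring_nf

theorem regular_pow (ω : (σ → ℤ) →+ ℤ) (v : σ → ℤ) (hv : ω v = 1) (q : R σ) (hq : Hom0 ω q)
    (g : R σ) (N : ℕ) (h : q ∣ (1 + single v 1) ^ N * g) : q ∣ g := by
  induction N with
  | zero => simpa using h
  | succ N ih =>
    rw [pow_succ', mul_assoc] at h
    exact ih (regular ω v hv q hq _ h)

/-- units -/
theorem unit_single (r s : R σ) (e : σ → ℤ) (h : r * s = single e 1) :
    ∃ a ε, (ε = 1 ∨ ε = -1) ∧ r = single a ε := by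
  have hr : r ≠ 0 := by rintro rfl; simp at h; exact one_ne_zero (α := ℤ) (by
    have := congrArg (fun f => f.coeff e) h; simpa using this.symm)
  have hs : s ≠ 0 := by rintro rfl; simp at h; exact one_ne_zero (α := ℤ) (by
    have := congrArg (fun f => f.coeff e) h; simpa using this.symm)
  have hrn : r.coeff.support.Nonempty := by simpa [Finsupp.support_nonempty_iff] using hr
  have hsn : s.coeff.support.Nonempty := by simpa [Finsupp.support_nonempty_iff] using hs
  have hcard : ¬ 1 < r.coeff.support.card * s.coeff.support.card := by
    intro hc
    obtain ⟨p1, hp1, p2, hp2, hne, hu1, hu2⟩ :=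
      TwoUniqueSums.uniqueAdd_of_one_lt_card hc
    rw [Finset.mem_product] at hp1 hp2
    have key : ∀ p : (σ → ℤ) × (σ → ℤ), p.1 ∈ r.coeff.support → p.2 ∈ s.coeff.support →
        UniqueAdd r.coeff.support s.coeff.support p.1 p.2 → p.1 + p.2 = e := by
      intro p h1 h2 hu
      have h3 := coeff_mul_add_of_uniqueAdd hu
      rw [h, coeff_single, Finsupp.single_apply] at h3
      by_contra h4
      rw [if_neg (fun h => h4 h.symm)] at h3
      rw [Finsupp.mem_support_iff] at h1 h2
      exact mul_ne_zero h1 h2 h3.symm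
    have e1 := key p1 hp1.1 hp1.2 hu1
    have e2 := key p2 hp2.1 hp2.2 hu2
    have := hu1 hp2.1 hp2.2 (by rw [e1, e2])
    exact hne (Prod.ext this.1.symm this.2.symm)
  have hr1 : r.coeff.support.card = 1 := by
    have := hrn.card_pos; have := hsn.card_pos; nlinarith
  have hs1 : s.coeff.support.card = 1 := by
    have := hrn.card_pos; have := hsn.card_pos; nlinarith
  obtain ⟨a, ha⟩ := Finsupp.card_support_eq_one'.mp hr1
  obtain ⟨b, hb⟩ := Finsupp.card_support_eq_one'.mp hs1
  obtain ⟨c, hc0, hc⟩ := ha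
  obtain ⟨d, hd0, hd⟩ := hb
  have hr' : r = single a c := coeff_injective hc
  have hs' : s = single b d := coeff_injective hd
  rw [hr', hs', single_mul_single, single_inj] at h
  refine ⟨a, c, ?_, hr'⟩
  rcases h with h | h
  · exact Int.eq_one_or_neg_one_of_mul_eq_one h.2
  · exact absurd h.2 one_ne_zero

end CAX

namespace CAX
open AddMonoidAlgebra
set_option linter.all false

variable {σ : Type} [Fintype σ] {K : Type} [Field K]

/-- Laurent monomial -/
noncomputable def mono (x : σ → K) (e : σ → ℤ) : K := ∏ s, x s ^ e s

theorem mono_zero (x : σ → K) : mono x 0 = 1 := by simp [mono]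

theorem mono_add {x : σ → K} (hx : ∀ s, x s ≠ 0) (e e' : σ → ℤ) :
    mono x (e + e') = mono x e * mono x e' := by
  simp only [mono, ← Finset.prod_mul_distrib]
  exact Finset.prod_congr rfl fun s _ => by rw [Pi.add_apply, zpow_add₀ (hx s)]

theorem mono_neg (x : σ → K) (e : σ → ℤ) : mono x (-e) = (mono x e)⁻¹ := by
  simp [mono]

theorem mono_ne {x : σ → K} (hx : ∀ s, x s ≠ 0) (e : σ → ℤ) : mono x e ≠ 0 :=
  Finset.prod_ne_zero_iff.mpr fun s _ => zpow_ne_zero _ (hx s)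

theorem mono_nsmul (x : σ → K) (e : σ → ℤ) (n : ℤ) : mono x (n • e) = mono x e ^ n := by
  simp only [mono, ← Finset.prod_zpow]
  exact Finset.prod_congr rfl fun s _ => by
    rw [Pi.smul_apply, smul_eq_mul, mul_comm, zpow_mul]

theorem mono_pi_single (x : σ → K) (s : σ) (a : ℤ) : mono x (Pi.single s a) = x s ^ a := by
  rw [mono, Finset.prod_eq_single s]
  · simp
  · intro b _ hb; simp [hb]
  · simp

theorem mono_update (x : σ → K) (j : σ) (a : K) (e : σ → ℤ) :
    mono (Function.update x j a) e = mono x (Function.update e j 0) * a ^ e j := by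
  rw [mono, mono, ← Finset.mul_prod_erase _ _ (Finset.mem_univ j),
    ← Finset.mul_prod_erase Finset.univ (fun s => x s ^ (Function.update e j 0) s)
      (Finset.mem_univ j)]
  simp only [Function.update_self, zpow_zero, one_mul]
  rw [mul_comm]
  congr 1
  apply Finset.prod_congr rfl
  intro s hs
  rw [Function.update_of_ne (Finset.ne_of_mem_erase hs),
    Function.update_of_ne (Finset.ne_of_mem_erase hs)]

theorem mono_update_of (x : σ → K) (j : σ) (a : K) (e : σ → ℤ) (h : e j = 0) :
    mono (Function.update x j a) e = mono x e := by
  rw [mono_update, h, zpow_zero, mul_one, ← h, Function.update_eq_self]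

theorem mono_mem (T : Subring K) (x : σ → K) (e : σ → ℤ) (h1 : ∀ s, 0 < e s → x s ∈ T)
    (h2 : ∀ s, e s < 0 → (x s)⁻¹ ∈ T) : mono x e ∈ T := by
  apply Subring.prod_mem
  intro s _
  rcases lt_trichotomy (e s) 0 with h | h | h
  · obtain ⟨m, hm⟩ := Int.eq_ofNat_of_zero_le (by linarith : 0 ≤ -e s)
    have : e s = -(m : ℤ) := by linarith
    rw [this, zpow_neg, zpow_natCast, ← inv_pow]
    exact Subring.pow_mem _ (h2 s h) _
  · rw [h, zpow_zero]; exact Subring.one_mem _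
  · obtain ⟨m, hm⟩ := Int.eq_ofNat_of_zero_le h.le
    rw [hm]
    rw [zpow_natCast]
    exact Subring.pow_mem _ (h1 s h) _

/-- evaluation -/
noncomputable def ev (x : σ → K) (hx : ∀ s, x s ≠ 0) : R σ →+* K :=
  (lift ℤ K (σ → ℤ)
    { toFun := fun e => mono x e.toAdd
      map_one' := by simp [mono_zero]
      map_mul' := fun a b => by rw [toAdd_mul, mono_add hx] }).toRingHom

theorem ev_single (x : σ → K) (hx : ∀ s, x s ≠ 0) (e : σ → ℤ) (c : ℤ) :
    ev x hx (single e c) = c * mono x e := by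
  simp [ev, lift_single]

/-- Laurent ring -/
def LR (x : σ → K) : Subring K := Subring.closure (Set.range x ∪ Set.range fun s => (x s)⁻¹)

theorem LR_mem (x : σ → K) (s : σ) : x s ∈ LR x :=
  Subring.subset_closure (Or.inl ⟨s, rfl⟩)

theorem LR_mem_inv (x : σ → K) (s : σ) : (x s)⁻¹ ∈ LR x :=
  Subring.subset_closure (Or.inr ⟨s, rfl⟩)

theorem LR_mono (x : σ → K) (e : σ → ℤ) : mono x e ∈ LR x :=
  mono_mem _ _ _ (fun s _ => LR_mem x s) (fun s _ => LR_mem_inv x s)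

theorem LR_le (x : σ → K) (T : Subring K) (h1 : ∀ s, x s ∈ T) (h2 : ∀ s, (x s)⁻¹ ∈ T) :
    LR x ≤ T := by
  rw [LR, Subring.closure_le]
  rintro _ (⟨s, rfl⟩ | ⟨s, rfl⟩)
  · exact h1 s
  · exact h2 s

theorem mem_LR_iff (x : σ → K) (hx : ∀ s, x s ≠ 0) (u : K) :
    u ∈ LR x ↔ ∃ f, ev x hx f = u := by
  constructor
  · intro h
    have : LR x ≤ (ev x hx).range := by
      apply LR_le
      · intro s
        refine ⟨single (Pi.single s 1) 1, ?_⟩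
        rw [ev_single, mono_pi_single]; simp
      · intro s
        refine ⟨single (Pi.single s (-1)) 1, ?_⟩
        rw [ev_single, mono_pi_single]; simp
    exact this h
  · rintro ⟨f, rfl⟩
    induction f using R_induction with
    | h0 => rw [map_zero]; exact Subring.zero_mem _
    | hadd f g hf hg => rw [map_add]; exact Subring.add_mem _ hf hg
    | hs e c => rw [ev_single]; exact Subring.mul_mem _ (intCast_mem _ c) (LR_mono x e)

/-- independence -/
structure Indep (x : σ → K) : Prop where
  ne : ∀ s, x s ≠ 0
  inj : ∀ f, ev x ne f = 0 → f = 0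

theorem Indep.inj' {x : σ → K} (h : Indep x) {f g : R σ} (hh : ev x h.ne f = ev x h.ne g) :
    f = g := by
  rw [← sub_eq_zero]; apply h.inj; rw [map_sub, hh, sub_self]

def bp (b : σ → ℤ) : σ → ℤ := fun s => max (b s) 0
def bn (b : σ → ℤ) : σ → ℤ := fun s => max (-b s) 0

theorem bp_eq (b : σ → ℤ) : bp b = bn b + b := by
  funext s; simp only [bp, bn, Pi.add_apply]; omega

/-- exchange binomial -/
noncomputable def EX (x : σ → K) (b : σ → ℤ) : K := mono x (bp b) + mono x (bn b)

noncomputable def PR (b : σ → ℤ) : R σ := single (bp b) 1 + single (bn b) 1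

theorem ev_PR (x : σ → K) (hx : ∀ s, x s ≠ 0) (b : σ → ℤ) : ev x hx (PR b) = EX x b := by
  simp [PR, EX, ev_single]

theorem PR_ne (b : σ → ℤ) : PR b ≠ 0 := by
  intro h
  have := congrArg (fun f => f.coeff (bp b)) h
  simp only [PR, coeff_add, coeff_single, Finsupp.add_apply, Finsupp.single_apply, coeff_zero,
    Finsupp.zero_apply] at this
  split_ifs at this <;> simp at this

theorem EX_eq {x : σ → K} (hx : ∀ s, x s ≠ 0) (b : σ → ℤ) :
    EX x b = mono x (bn b) * (1 + mono x b) := by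
  rw [EX, bp_eq, mono_add hx]; ring

theorem EX_ne {x : σ → K} (h : Indep x) (b : σ → ℤ) : EX x b ≠ 0 := by
  rw [← ev_PR x h.ne]
  exact fun hh => PR_ne b (h.inj _ hh)

theorem EX_neg (x : σ → K) (b : σ → ℤ) : EX x (-b) = EX x b := by
  have h1 : bp (-b) = bn b := rfl
  have h2 : bn (-b) = bp b := by funext s; simp [bn, bp]
  rw [EX, EX, h1, h2, add_comm]

/-- mutation -/
noncomputable def mu (x : σ → K) (j : σ) (b : σ → ℤ) : σ → K :=
  Function.update x j (EX x b / x j)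

theorem mu_self (x : σ → K) (j : σ) (b : σ → ℤ) : mu x j b j = EX x b / x j := by simp [mu]

theorem mu_of_ne (x : σ → K) {i j : σ} (b : σ → ℤ) (h : i ≠ j) : mu x j b i = x i := by
  simp [mu, h]

theorem EX_update (x : σ → K) (j : σ) (a : K) (b : σ → ℤ) (h : b j = 0) :
    EX (Function.update x j a) b = EX x b := by
  rw [EX, EX, mono_update_of, mono_update_of] <;> simp [bp, bn, h]

theorem mu_ne {x : σ → K} (h : Indep x) (j : σ) (b : σ → ℤ) (s : σ) : mu x j b s ≠ 0 := by
  by_cases hs : s = j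
  · subst hs; rw [mu_self]; exact div_ne_zero (EX_ne h b) (h.ne _)
  · rw [mu_of_ne _ _ hs]; exact h.ne s

theorem mu_mu {x : σ → K} (h : Indep x) (j : σ) (b : σ → ℤ) (hb : b j = 0) :
    mu (mu x j b) j b = x := by
  funext s
  by_cases hs : s = j
  · subst hs
    rw [mu_self, mu_self]
    have : EX (mu x s b) b = EX x b := EX_update _ _ _ _ hb
    rw [this]
    have := EX_ne h b
    have := h.ne s
    field_simp
  · rw [mu_of_ne _ _ hs, mu_of_ne _ _ hs]

theorem mu_neg (x : σ → K) (j : σ) (b : σ → ℤ) : mu x j (-b) = mu x j b := by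
  rw [mu, mu, EX_neg]

/-- coordinate -/
def cd (j : σ) : (σ → ℤ) →+ ℤ := Pi.evalAddMonoidHom (fun _ => ℤ) j

theorem cd_apply (j : σ) (e : σ → ℤ) : cd j e = e j := rfl

theorem PR_hom0 (j : σ) (b : σ → ℤ) (hb : b j = 0) : Hom0 (cd j) (PR b) := by
  apply Hom0.add <;> apply Hom0.single <;> simp [cd_apply, bp, bn, hb]

/-- flip the coordinate j -/
noncomputable def flipE (j : σ) : (σ → ℤ) →+ (σ → ℤ) where
  toFun e := Function.update e j (-e j)
  map_zero' := by funext s; by_cases h : s = j <;> simp [Function.update_apply, h]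
  map_add' a b := by
    funext s
    by_cases h : s = j
    · subst h; simp; ring
    · simp [h]

noncomputable def flipR (j : σ) : R σ →+* R σ := AddMonoidAlgebra.mapDomainRingHom ℤ (flipE j)

theorem flipR_single (j : σ) (e : σ → ℤ) (c : ℤ) :
    flipR j (single e c) = single (Function.update e j (-e j)) c := by
  simp [flipR, flipE]

theorem flipR_flipR (j : σ) (f : R σ) : flipR j (flipR j f) = f := by
  induction f using R_induction with
  | h0 => simp
  | hadd f g hf hg => simp [hf, hg]
  | hs e c => simp [flipR_single]

theorem sl_flip (j : σ) (d : ℤ) (f : R σ) :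
    sl (cd j) (-d) (flipR j f) = flipR j (sl (cd j) d f) := by
  induction f using R_induction with
  | h0 => simp
  | hadd f g hf hg => simp [hf, hg]
  | hs e c =>
    rw [flipR_single, sl_single, sl_single]
    have hu : cd j (Function.update e j (-e j)) = -cd j e := by simp [cd_apply]
    rw [hu]
    by_cases h : cd j e = d
    · rw [if_pos h, if_pos (by rw [h]), flipR_single]
    · rw [if_neg h, if_neg (fun h2 => h (neg_injective h2)), map_zero]

theorem sl_sl (ω : (σ → ℤ) →+ ℤ) (d a : ℤ) (f : R σ) :
    sl ω d (sl ω a f) = if a = d then sl ω a f else 0 := by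
  induction f using R_induction with
  | h0 => simp
  | hadd f g hf hg =>
    rw [map_add, map_add, hf, hg]; split_ifs <;> simp
  | hs e c =>
    rw [sl_single]
    by_cases h : ω e = a
    · rw [if_pos h, sl_single, h]
    · simp [h]

theorem ev_mu_sl {x : σ → K} (h : Indep x) (j : σ) (b : σ → ℤ)
    (a : ℤ) (g : R σ) :
    ev (mu x j b) (mu_ne h j b) (sl (cd j) a g) =
      EX x b ^ a * ev x h.ne (flipR j (sl (cd j) a g)) := by
  induction g using R_induction with
  | h0 => simp
  | hadd f g hf hg => simp only [map_add, hf, hg]; ring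
  | hs e c =>
    rw [sl_single]
    split_ifs with he
    · rw [flipR_single, ev_single, ev_single, mu, mono_update]
      rw [cd_apply] at he
      rw [he]
      have h1 : (Function.update e j (-a)) = Function.update e j 0 + Pi.single j (-a) := by
        funext s; by_cases hs : s = j
        · subst hs; simp
        · simp [hs]
      rw [h1, mono_add h.ne, mono_pi_single, div_zpow, zpow_neg]
      ring
    · simp

theorem KF {x : σ → K} (h : Indep x) (j : σ) (b : σ → ℤ) (hb : b j = 0) (f g : R σ)
    (hfg : ev x h.ne f = ev (mu x j b) (mu_ne h j b) g) (d : ℤ) :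
    ∃ N : ℕ, 0 ≤ d + N ∧
    PR b ^ N * sl (cd j) (-d) f = PR b ^ (d + N).toNat * flipR j (sl (cd j) d g) := by
  obtain ⟨M, hM, hs⟩ := exists_bound (cd j) g
  refine ⟨M + d.natAbs, by omega, ?_⟩
  have hP := EX_ne h b
  set N : ℕ := M + d.natAbs with hN
  have h1 : PR b ^ N * f = ∑ a ∈ Finset.Icc (-(M : ℤ)) M,
      PR b ^ (a + N).toNat * flipR j (sl (cd j) a g) := by
    apply h.inj'
    rw [map_mul, hfg, map_sum, map_pow, ev_PR]
    conv_lhs => rw [hs]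
    rw [map_sum, Finset.mul_sum]
    apply Finset.sum_congr rfl
    intro a ha
    rw [Finset.mem_Icc] at ha
    rw [ev_mu_sl h, map_mul, map_pow, ev_PR, ← mul_assoc]
    congr 1
    rw [← zpow_natCast, ← zpow_natCast, Int.toNat_of_nonneg (by omega), zpow_add₀ hP, mul_comm]
  have h2 := congrArg (sl (cd j) (-d)) h1
  rw [(PR_hom0 j b hb).pow, map_sum] at h2
  rw [h2]
  have h3 : ∀ a ∈ Finset.Icc (-(M : ℤ)) M,
      sl (cd j) (-d) (PR b ^ (a + N).toNat * flipR j (sl (cd j) a g)) =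
      if d = a then PR b ^ (d + N).toNat * flipR j (sl (cd j) d g) else 0 := by
    intro a _
    rw [(PR_hom0 j b hb).pow, sl_flip, sl_sl]
    by_cases had : a = d
    · subst had; simp
    · rw [if_neg had, if_neg (fun h => had h.symm)]; simp
  rw [Finset.sum_congr rfl h3, Finset.sum_ite_eq]
  split_ifs with h4
  · rfl
  · rw [hM d]
    · simp
    · rw [Finset.mem_Icc] at h4
      by_contra h3
      push Not at h3
      exact h4 (abs_le.mp h3)

theorem Indep.mu {x : σ → K} (h : Indep x) (j : σ) (b : σ → ℤ) (hb : b j = 0) :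
    Indep (mu x j b) := by
  refine ⟨mu_ne h j b, fun g hg => ?_⟩
  obtain ⟨M, hM, hs⟩ := exists_bound (cd j) g
  rw [hs]
  apply Finset.sum_eq_zero
  intro d _
  obtain ⟨N, hN, h1⟩ := KF h j b hb 0 g (by rw [hg, map_zero]) d
  rw [map_zero, mul_zero] at h1
  have h2 := (mul_eq_zero.mp h1.symm).resolve_left (pow_ne_zero _ (PR_ne b))
  rw [← flipR_flipR j (sl (cd j) d g), h2, map_zero]

theorem ev_sl_mem {x : σ → K} (hx : ∀ s, x s ≠ 0) (j : σ) (T : Subring K)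
    (h1 : ∀ i, i ≠ j → x i ∈ T) (h2 : ∀ i, i ≠ j → (x i)⁻¹ ∈ T) (h3 : x j ∈ T) (d : ℤ)
    (hd : 0 ≤ d) (g : R σ) : ev x hx (sl (cd j) d g) ∈ T := by
  induction g using R_induction with
  | h0 => simp
  | hadd f g hf hg => rw [map_add, map_add]; exact Subring.add_mem _ hf hg
  | hs e c =>
    rw [sl_single]
    split_ifs with he
    · rw [ev_single]
      apply Subring.mul_mem _ (intCast_mem _ c)
      rw [cd_apply] at he
      apply mono_mem
      · intro s _
        by_cases hs : s = j
        · rw [hs]; exact h3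
        · exact h1 s hs
      · intro s hs'
        apply h2 s
        rintro rfl
        omega
    · simp

/-- intersection of two adjacent Laurent rings -/
theorem inter_mem {x : σ → K} (h : Indep x) (j : σ) (b : σ → ℤ) (hb : b j = 0) (T : Subring K)
    (h1 : ∀ i, i ≠ j → x i ∈ T) (h2 : ∀ i, i ≠ j → (x i)⁻¹ ∈ T) (h3 : x j ∈ T)
    (h4 : EX x b / x j ∈ T) (u : K) (hu : u ∈ LR x) (hu' : u ∈ LR (mu x j b)) : u ∈ T := by
  rw [mem_LR_iff x h.ne] at hu
  rw [mem_LR_iff _ (mu_ne h j b)] at hu'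
  obtain ⟨f, hf⟩ := hu
  obtain ⟨g, hg⟩ := hu'
  obtain ⟨M, hM, hs⟩ := exists_bound (cd j) f
  rw [← hf, hs, map_sum]
  apply Subring.sum_mem
  intro d _
  by_cases hd : 0 ≤ d
  · exact ev_sl_mem h.ne j T h1 h2 h3 d hd f
  · obtain ⟨N, hN, h5⟩ := KF h j b hb f g (by rw [hf, hg]) (-d)
    have h6 : (-d + N).toNat = (-d).toNat + N := by omega
    rw [h6, pow_add, mul_comm (PR b ^ (-d).toNat), mul_assoc] at h5
    have h7 := mul_left_cancel₀ (pow_ne_zero _ (PR_ne b)) h5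
    rw [neg_neg] at h7
    have h8 := ev_mu_sl h j b (-d) g
    rw [h7, map_mul, map_pow, ev_PR, ← zpow_natCast, Int.toNat_of_nonneg (by omega), ← h8]
    apply ev_sl_mem (mu_ne h j b) j T
    · intro i hi; rw [mu_of_ne _ _ hi]; exact h1 i hi
    · intro i hi; rw [mu_of_ne _ _ hi]; exact h2 i hi
    · rw [mu_self]; exact h4
    · omega

/-- localization -/
def locS (T : Subring K) (D : K) (hD : D ∈ T) : Subring K where
  carrier := {u | ∃ N : ℕ, u * D ^ N ∈ T}
  mul_mem' := by
    rintro a b ⟨N, hN⟩ ⟨M, hM⟩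
    refine ⟨N + M, ?_⟩
    have : a * b * D ^ (N + M) = (a * D ^ N) * (b * D ^ M) := by ring
    rw [this]; exact T.mul_mem hN hM
  one_mem' := ⟨0, by simp⟩
  add_mem' := by
    rintro a b ⟨N, hN⟩ ⟨M, hM⟩
    refine ⟨N + M, ?_⟩
    have : (a + b) * D ^ (N + M) = (a * D ^ N) * D ^ M + (b * D ^ M) * D ^ N := by ring
    rw [this]
    exact T.add_mem (T.mul_mem hN (T.pow_mem hD _)) (T.mul_mem hM (T.pow_mem hD _))
  zero_mem' := ⟨0, by simp⟩
  neg_mem' := by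
    rintro a ⟨N, hN⟩
    exact ⟨N, by rw [neg_mul]; exact T.neg_mem hN⟩

theorem mem_locS {T : Subring K} {D : K} {hD : D ∈ T} {u : K} :
    u ∈ locS T D hD ↔ ∃ N : ℕ, u * D ^ N ∈ T := Iff.rfl

theorem le_locS {T : Subring K} {D : K} {hD : D ∈ T} {u : K} (h : u ∈ T) : u ∈ locS T D hD :=
  ⟨0, by simpa using h⟩

theorem EX_mem_mu (x : σ → K) (j : σ) (b : σ → ℤ) (hb : b j = 0) : EX x b ∈ LR (mu x j b) := by
  rw [← EX_update x j (EX x b / x j) b hb]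
  exact Subring.add_mem _ (LR_mono _ _) (LR_mono _ _)

theorem self_mem_mu {x : σ → K} (h : Indep x) (j : σ) (b : σ → ℤ) (hb : b j = 0) (s : σ) :
    x s ∈ LR (mu x j b) := by
  by_cases hs : s = j
  · subst hs
    have h1 : x s = EX x b * (mu x s b s)⁻¹ := by
      rw [mu_self]; have := EX_ne h b; have := h.ne s; field_simp
    rw [h1]
    exact Subring.mul_mem _ (EX_mem_mu x s b hb) (LR_mem_inv _ _)
  · rw [← mu_of_ne x b hs]; exact LR_mem _ _

theorem loc_mu {x : σ → K} (h : Indep x) (j : σ) (b : σ → ℤ) (hb : b j = 0) (u : K)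
    (hu : u ∈ LR x) : ∃ N : ℕ, u * EX x b ^ N ∈ LR (mu x j b) := by
  have : LR x ≤ locS (LR (mu x j b)) (EX x b) (EX_mem_mu x j b hb) := by
    apply LR_le
    · intro s; exact le_locS (self_mem_mu h j b hb s)
    · intro s
      by_cases hs : s = j
      · subst hs
        refine ⟨1, ?_⟩
        have h1 : (x s)⁻¹ * EX x b ^ 1 = mu x s b s := by rw [mu_self]; ring
        rw [h1]; exact LR_mem _ _
      · apply le_locS
        rw [← mu_of_ne x b hs]; exact LR_mem_inv _ _
  exact this hu

theorem regular_K {x : σ → K} (h : Indep x) (ω : (σ → ℤ) →+ ℤ) (b1 b2 : σ → ℤ)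
    (h1 : ω b1 = 1) (h2 : ω b2 = 0) (u : K) (N M : ℕ) (hN : u * EX x b1 ^ N ∈ LR x)
    (hM : u * EX x b2 ^ M ∈ LR x) : u ∈ LR x := by
  have red : ∀ (b : σ → ℤ) (N : ℕ), u * EX x b ^ N ∈ LR x → u * (1 + mono x b) ^ N ∈ LR x := by
    intro b N hb
    have : u * (1 + mono x b) ^ N = u * EX x b ^ N * (mono x (-bn b)) ^ N := by
      rw [EX_eq h.ne, mono_neg, mul_pow]
      have h7 := pow_ne_zero N (mono_ne h.ne (bn b))
      rw [inv_pow]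
      field_simp
    rw [this]
    exact Subring.mul_mem _ hb (Subring.pow_mem _ (LR_mono _ _) _)
  have hN' := red _ _ hN
  have hM' := red _ _ hM
  rw [mem_LR_iff x h.ne] at hN' hM'
  obtain ⟨f, hf⟩ := hN'
  obtain ⟨g, hg⟩ := hM'
  have evb : ∀ b : σ → ℤ, ev x h.ne (1 + single b 1) = 1 + mono x b := by
    intro b; rw [map_add, map_one, ev_single]; simp
  have h3 : (1 + single b1 1) ^ N * g = (1 + single b2 1) ^ M * f := by
    apply h.inj'
    rw [map_mul, map_mul, map_pow, map_pow, evb, evb, hf, hg]; ring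
  have hq : Hom0 ω ((1 + single b2 1 : R σ) ^ M) := (Hom0.one.add (Hom0.single h2 1)).pow M
  obtain ⟨k, hk⟩ := regular_pow ω b1 h1 _ hq g N (Dvd.intro _ h3.symm)
  have h4 : (1 + mono x b2) ≠ 0 := by
    intro h0
    apply EX_ne h b2
    rw [EX_eq h.ne, h0, mul_zero]
  rw [hk, map_mul, map_pow, evb] at hg
  rw [mem_LR_iff x h.ne]
  refine ⟨k, ?_⟩
  have h5 := pow_ne_zero M h4
  apply mul_left_cancel₀ h5
  rw [hg, mul_comm]

end CAX

namespace CAX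
open AddMonoidAlgebra
set_option linter.all false

variable {σ : Type} [Fintype σ] {K : Type} [Field K]

theorem coprime_mem (S : Subring K) (p q a b u : K) (hp : p ∈ S) (hq : q ∈ S) (ha : a ∈ S)
    (hb : b ∈ S) (hab : a * p + b * q = 1) (N M : ℕ) (h1 : u * p ^ N ∈ S) (h2 : u * q ^ M ∈ S) :
    u ∈ S := by
  have hc : IsCoprime (⟨p, hp⟩ : S) ⟨q, hq⟩ := ⟨⟨a, ha⟩, ⟨b, hb⟩, Subtype.ext hab⟩
  obtain ⟨c, d, hcd⟩ := hc.pow (m := N) (n := M)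
  have h3 := congrArg (Subtype.val) hcd
  simp only [Subring.coe_add, Subring.coe_mul, Subring.coe_pow, Subring.coe_one] at h3
  have : u = c * (u * p ^ N) + d * (u * q ^ M) := by
    calc u = u * 1 := by ring
      _ = _ := by rw [← h3]; ring
  rw [this]
  exact S.add_mem (S.mul_mem c.2 h1) (S.mul_mem d.2 h2)

theorem rank2_pos {x : σ → K} (h : Indep x) (j k : σ) (hjk : j ≠ k) (bj bk c : σ → ℤ)
    (hj : bj j = 0) (hk : bk k = 0) (hg : 0 < bj k) (hb : bk j < 0)
    (hck : c k = - bj k) (hc : ∀ s, s ≠ k → c s = bj s + bj k * max (bk s) 0)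
    (u : K) (h1 : u ∈ LR x) (h2 : u ∈ LR (mu x j bj)) (h3 : u ∈ LR (mu x k bk)) :
    u ∈ LR (mu (mu x k bk) j c) := by
  have hcj : c j = 0 := by rw [hc j hjk, hj, max_eq_right hb.le]; ring
  have hy := h.mu k bk hk
  set y := mu x k bk with hydef
  have hz := hy.mu j c hcj
  set z := mu y j c with hzdef
  set S := LR z with hS
  have zs : ∀ s, s ≠ j → s ≠ k → z s = x s := fun s a b => by
    rw [hzdef, mu_of_ne _ _ a, hydef, mu_of_ne _ _ b]
  have xS : ∀ s, s ≠ j → s ≠ k → x s ∈ S := fun s a b => by rw [← zs s a b]; exact LR_mem _ _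
  have xS' : ∀ s, s ≠ j → s ≠ k → (x s)⁻¹ ∈ S := fun s a b => by
    rw [← zs s a b]; exact LR_mem_inv _ _
  have yj : y j = x j := by rw [hydef, mu_of_ne _ _ hjk]
  have xjS : x j ∈ S := by rw [← yj]; exact self_mem_mu hy j c hcj j
  have PjS : EX y c ∈ S := EX_mem_mu y j c hcj
  have zj : z j = EX y c / x j := by rw [hzdef, mu_self, yj]
  have zk : z k = EX x bk / x k := by rw [hzdef, mu_of_ne _ _ hjk.symm, hydef, mu_self]
  have M2S : mono x (bp bk) ∈ S := by
    apply mono_mem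
    · intro s hs
      apply xS
      · rintro rfl; simp only [bp] at hs; omega
      · rintro rfl; simp only [bp] at hs; omega
    · intro s hs; simp only [bp] at hs; omega
  have M2S' : (mono x (bp bk))⁻¹ ∈ S := by
    rw [← mono_neg]
    apply mono_mem
    · intro s hs; simp only [bp, Pi.neg_apply] at hs; omega
    · intro s hs
      apply xS'
      · rintro rfl; simp only [bp, Pi.neg_apply] at hs; omega
      · rintro rfl; simp only [bp, Pi.neg_apply] at hs; omega
  set Q := mono x (bn bk - Pi.single j 1) with hQ
  have QS : Q ∈ S := by
    apply mono_mem
    · intro s hs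
      by_cases hsj : s = j
      · subst hsj; exact xjS
      apply xS _ hsj
      rintro rfl; simp [bn, hk, hsj] at hs
    · intro s hs
      exfalso
      by_cases hsj : s = j
      · subst hsj; simp [bn] at hs; omega
      · simp [bn, hsj] at hs
  have hM1 : mono x (bn bk) = x j * Q := by
    have : bn bk = (bn bk - Pi.single j 1) + Pi.single j 1 := by simp
    rw [this, mono_add h.ne, mono_pi_single, zpow_one, mul_comm]
  set M2 := mono x (bp bk) with hM2
  have hPk : EX x bk = M2 + x j * Q := by rw [EX, hM1]
  set Pk := EX x bk with hPkd
  have PkS : Pk ∈ S := by rw [hPk]; exact S.add_mem M2S (S.mul_mem xjS QS)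
  have Pk0 : Pk ≠ 0 := EX_ne h bk
  have M20 : M2 ≠ 0 := mono_ne h.ne _
  have xkS : x k ∈ S := by
    have : x k = Pk * (z k)⁻¹ := by rw [zk]; have := h.ne k; field_simp
    rw [this]; exact S.mul_mem PkS (LR_mem_inv _ _)
  have xallS : ∀ s, x s ∈ S := by
    intro s
    by_cases a : s = j
    · rw [a]; exact xjS
    by_cases b : s = k
    · rw [b]; exact xkS
    exact xS s a b
  obtain ⟨g, hgn⟩ : ∃ g : ℕ, bj k = g := ⟨(bj k).toNat, by omega⟩
  have hyh : mono y c * Pk ^ g = mono x bj * M2 ^ g := by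
    have e1 : Function.update c k 0 = bj + (g : ℤ) • bp bk + Pi.single k (-(g:ℤ)) := by
      funext s
      by_cases hs : s = k
      · subst hs; simp [bp, hk, hgn]
      · simp [hs, hc s hs, bp, hgn]
    rw [hydef, mu, mono_update, e1, mono_add h.ne, mono_add h.ne, mono_nsmul, mono_pi_single, hck,
      hgn, ← hM2, ← hPkd]
    have := h.ne k
    rw [zpow_neg, zpow_neg, zpow_natCast, zpow_natCast, zpow_natCast, div_pow]
    have := pow_ne_zero g this
    have := pow_ne_zero g Pk0
    field_simp
  have mjS : mono x (bn bj) ∈ S := by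
    apply mono_mem
    · intro s _; exact xallS s
    · intro s hs; simp only [bn] at hs; omega
  have hmz : mono y (bn c) = mono z (bn c) := by
    rw [hzdef, mu, mono_update_of]; simp [bn, hcj]
  have mS : (mono y (bn c))⁻¹ ∈ S := by
    rw [hmz, ← mono_neg]; exact LR_mono _ _
  have m0 : mono y (bn c) ≠ 0 := mono_ne hy.ne _
  obtain ⟨t, ht⟩ : (⟨x j * Q, S.mul_mem xjS QS⟩ : S) ∣ (⟨Pk, PkS⟩ : S) ^ g - (⟨M2, M2S⟩ : S) ^ g := by
    have := sub_dvd_pow_sub_pow (⟨Pk, PkS⟩ : S) (⟨M2, M2S⟩ : S) g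
    convert this using 1
    apply Subtype.ext
    simp [hPk]
  have ht' : Pk ^ g - M2 ^ g = x j * Q * (t : K) := by
    have := congrArg Subtype.val ht
    simpa using this
  have key : EX x bj / x j = mono x (bn bj) * (M2⁻¹) ^ g *
      (z j * Pk ^ g * (mono y (bn c))⁻¹ - Q * t) := by
    have hxj := h.ne j
    have e2 : z j * Pk ^ g * (mono y (bn c))⁻¹ = (Pk ^ g + mono x bj * M2 ^ g) / x j := by
      rw [zj, EX_eq hy.ne, ← hyh]; field_simp
    have e3 : Q * t = (Pk ^ g - M2 ^ g) / x j := by rw [ht']; field_simp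
    rw [e2, e3, EX_eq h.ne, inv_pow]
    have := pow_ne_zero g M20
    field_simp
    ring
  have xj'S : EX x bj / x j ∈ S := by
    rw [key]
    refine S.mul_mem (S.mul_mem mjS (S.pow_mem M2S' _)) (S.sub_mem ?_ (S.mul_mem QS t.2))
    exact S.mul_mem (S.mul_mem (LR_mem _ _) (S.pow_mem PkS _)) mS
  have hT : u ∈ locS S Pk PkS := by
    apply inter_mem h j bj hj _ _ _ (le_locS xjS) (le_locS xj'S) u h1 h2
    · intro i hi; exact le_locS (xallS i)
    · intro i hi
      by_cases hik : i = k
      · subst hik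
        refine ⟨1, ?_⟩
        have : (x i)⁻¹ * Pk ^ 1 = z i := by rw [zk]; ring
        rw [this]; exact LR_mem _ _
      · exact le_locS (xS' i hi hik)
  obtain ⟨M, hM⟩ := mem_locS.mp hT
  obtain ⟨N, hN⟩ := loc_mu hy j c hcj u h3
  refine coprime_mem S Pk (EX y c) M2⁻¹ (-(M2⁻¹ * ((z j)⁻¹ * Q))) u PkS PjS M2S'
    (S.neg_mem (S.mul_mem M2S' (S.mul_mem (LR_mem_inv _ _) QS))) ?_ M N hM hN
  rw [zj, hPk]
  have hP0 := EX_ne hy c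
  have hxj := h.ne j
  field_simp
  ring

theorem rank2_zero {x : σ → K} (h : Indep x) (j k : σ) (hjk : j ≠ k) (bj bk : σ → ℤ)
    (hj : bj j = 0) (hk : bk k = 0) (hg : bj k = 0) (hb : bk j = 0)
    (ω : (σ → ℤ) →+ ℤ) (w1 : ω bj = 1) (w2 : ω bk = 0)
    (u : K) (h1 : u ∈ LR x) (h2 : u ∈ LR (mu x j bj)) (h3 : u ∈ LR (mu x k bk)) :
    u ∈ LR (mu (mu x k bk) j bj) := by
  have hy := h.mu k bk hk
  have hz := hy.mu j bj hj
  have hw := h.mu j bj hj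
  have e1 : mu (mu x k bk) j bj = mu (mu x j bj) k bk := by
    rw [mu, mu_of_ne _ _ hjk]
    conv_rhs => rw [mu, mu_of_ne _ _ hjk.symm]
    rw [mu, EX_update _ _ _ _ hg]
    conv_rhs => rw [mu, EX_update _ _ _ _ hb]
    exact (Function.update_comm hjk _ _ _).symm
  obtain ⟨N, hN⟩ := loc_mu hy j bj hj u h3
  obtain ⟨M, hM⟩ := loc_mu hw k bk hk u h2
  rw [← e1] at hM
  have e3 : ∀ (x : σ → K) a b c, (c : σ → ℤ) a = 0 → EX (mu x a b) c = EX x c := by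
    intro x a b c hc; rw [mu, EX_update _ _ _ _ hc]
  refine regular_K hz ω bj bk w1 w2 u N M ?_ ?_
  · rw [e3 _ _ _ _ hj]; exact hN
  · rw [e3 _ _ _ _ hb, e3 _ _ _ _ hk]
    rw [e3 _ _ _ _ hb] at hM
    exact hM

theorem rank2 {x : σ → K} (h : Indep x) (j k : σ) (hjk : j ≠ k) (bj bk c : σ → ℤ)
    (hj : bj j = 0) (hk : bk k = 0) (hs : (bj k = 0 ∧ bk j = 0) ∨ bj k * bk j < 0)
    (hck : c k = - bj k)
    (hc : ∀ s, s ≠ k → c s = bj s + (bk s).sign * max (bk s * bj k) 0)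
    (ω : (σ → ℤ) →+ ℤ) (w1 : ω bj = 1) (w2 : ω bk = 0)
    (u : K) (h1 : u ∈ LR x) (h2 : u ∈ LR (mu x j bj)) (h3 : u ∈ LR (mu x k bk)) :
    u ∈ LR (mu (mu x k bk) j c) := by
  rcases hs with ⟨a, b⟩ | hs
  · have : c = bj := by
      funext s
      by_cases hs : s = k
      · subst hs; rw [hck, a]; rfl
      · rw [hc s hs, a]; simp
    rw [this]
    exact rank2_zero h j k hjk bj bk hj hk a b ω w1 w2 u h1 h2 h3
  rcases mul_neg_iff.mp hs with ⟨a, b⟩ | ⟨a, b⟩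
  · refine rank2_pos h j k hjk bj bk c hj hk a b hck ?_ u h1 h2 h3
    intro s hsk
    rw [hc s hsk]
    rcases lt_trichotomy (bk s) 0 with h | h | h
    · rw [max_eq_right h.le, max_eq_right (by nlinarith)]; ring
    · rw [h]; simp
    · rw [max_eq_left h.le, max_eq_left (by nlinarith), Int.sign_eq_one_of_pos h]; ring
  · rw [← mu_neg _ j c, ← mu_neg _ k bk]
    rw [← mu_neg _ k bk] at h3
    rw [← mu_neg _ j bj] at h2
    refine rank2_pos h j k hjk (-bj) (-bk) (-c) (by simp [hj]) (by simp [hk]) (by simpa using a)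
      (by simpa using b) (by simp [hck]) ?_ u h1 h2 h3
    intro s hsk
    simp only [Pi.neg_apply]
    rw [hc s hsk]
    rcases lt_trichotomy (bk s) 0 with h | h | h
    · rw [max_eq_left (show (0:ℤ) ≤ - bk s by omega), max_eq_left (by nlinarith),
        Int.sign_eq_neg_one_of_neg h]; ring
    · rw [h]; simp
    · rw [max_eq_right (show - bk s ≤ (0:ℤ) by omega), max_eq_right (by nlinarith)]; ring

end CAX

namespace CAX
open AddMonoidAlgebra CA
set_option linter.all false

variable {n : ℕ}

theorem mono_pi_single' {σ : Type} [Fintype σ] [d : DecidableEq σ] {K : Type} [Field K] (x : σ → K)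
    (s : σ) (a : ℤ) : mono x (Pi.single s a) = x s ^ a := by
  have := mono_pi_single x s a
  convert this

theorem mono_split' {σ : Type} [Fintype σ] [d : DecidableEq σ] {K : Type} [Field K] (x : σ → K)
    (j : σ) (e : σ → ℤ) : mono x e = mono x (@Function.update σ (fun _ => ℤ) d e j 0) * x j ^ e j := by
  have := mono_update x j (x j) e
  have e1 : @Function.update σ (fun _ => K) (fun a b => Classical.propDecidable (a = b)) x j (x j)
    = x := @Function.update_eq_self _ _ (fun a b => Classical.propDecidable (a = b)) _ _
  rw [e1] at this
  convert this

abbrev EM (n : ℕ) := Matrix (Fin n ⊕ Fin n) (Fin n) ℤ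

def col (Bt : EM n) (j : Fin n) : Fin n ⊕ Fin n → ℤ := fun s => Bt s j

def sq (Bt : EM n) : Matrix (Fin n) (Fin n) ℤ := Matrix.of fun i j => Bt (Sum.inl i) j

structure Good (Bt : EM n) : Prop where
  ts : TSSS (sq Bt)
  surj : ∀ r : Fin n → ℤ, ∃ ω : Fin n ⊕ Fin n → ℤ, ∀ j, ∑ s, ω s * Bt s j = r j

theorem Good.sss {Bt : EM n} (h : Good Bt) (i j : Fin n) :
    (Bt (Sum.inl i) j = 0 ∧ Bt (Sum.inl j) i = 0) ∨ Bt (Sum.inl i) j * Bt (Sum.inl j) i < 0 :=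
  h.ts [] i j

theorem Good.diag {Bt : EM n} (h : Good Bt) (i : Fin n) : Bt (Sum.inl i) i = 0 := by
  rcases h.sss i i with h | h
  · exact h.1
  · nlinarith [mul_self_nonneg (Bt (Sum.inl i) i)]

theorem sq_mut (Bt : EM n) (k : Fin n) : sq (extMut Bt k) = matMut (sq Bt) k := by
  ext i j
  simp [sq, extMut, matMut]

theorem extMut_extMut (Bt : EM n) (k : Fin n) : extMut (extMut Bt k) k = Bt := by
  ext i j
  by_cases hi : i = Sum.inl k
  · simp [extMut, hi]
  by_cases hj : j = k
  · simp [extMut, hj]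
  · simp [extMut, hi, hj, Int.sign_neg]

theorem sgn_pp (a b : ℤ) : a.sign * pp (a * b) = a * max b 0 + max (-a) 0 * b := by
  unfold pp
  rcases lt_trichotomy a 0 with h | h | h
  · rw [Int.sign_eq_neg_one_of_neg h, max_eq_left (show 0 ≤ -a by omega)]
    rcases le_total b 0 with hb | hb
    · rw [max_eq_right hb, max_eq_left (by nlinarith)]; ring
    · rw [max_eq_left hb, max_eq_right (by nlinarith)]; ring
  · subst h; simp
  · rw [Int.sign_eq_one_of_pos h, max_eq_right (show -a ≤ 0 by omega)]
    rcases le_total b 0 with hb | hb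
    · rw [max_eq_right hb, max_eq_right (by nlinarith)]; ring
    · rw [max_eq_left hb, max_eq_left (by nlinarith)]; ring

/-- mutation of a weight row -/
def wm (Bt : EM n) (k : Fin n) (w : Fin n ⊕ Fin n → ℤ) : Fin n ⊕ Fin n → ℤ :=
  Function.update w (Sum.inl k) (-w (Sum.inl k) + ∑ s, max (-Bt s k) 0 * w s)

theorem wm_sum (Bt : EM n) (k : Fin n) (hk : Bt (Sum.inl k) k = 0) (w : Fin n ⊕ Fin n → ℤ)
    (j : Fin n) : ∑ s, wm Bt k w s * extMut Bt k s j =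
      if j = k then -∑ s, w s * Bt s k else
        ∑ s, w s * Bt s j + max (Bt (Sum.inl k) j) 0 * ∑ s, w s * Bt s k := by
  split_ifs with hj
  · subst hj
    rw [← Finset.sum_neg_distrib]
    apply Finset.sum_congr rfl
    intro s _
    by_cases hs : s = Sum.inl j
    · subst hs; simp [extMut, hk]
    · simp [extMut, wm, hs]
  · set W := -w (Sum.inl k) + ∑ s, max (-Bt s k) 0 * w s with hW
    have key : ∀ s, wm Bt k w s * extMut Bt k s j =
        w s * Bt s j + max (Bt (Sum.inl k) j) 0 * (w s * Bt s k)
          + Bt (Sum.inl k) j * (max (-Bt s k) 0 * w s)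
          + if s = Sum.inl k then (-w (Sum.inl k) - W) * Bt (Sum.inl k) j else 0 := by
      intro s
      by_cases hs : s = Sum.inl k
      · subst hs
        have e1 : wm Bt k w (Sum.inl k) = W := by rw [wm, Function.update_self]
        rw [e1, hk]; simp only [extMut, Matrix.of_apply, true_or, if_true]; simp; ring
      · simp only [extMut, wm, hs, hj, Matrix.of_apply, or_self, if_false, sgn_pp]
        rw [Function.update_of_ne hs]; ring
    simp only [key, Finset.sum_add_distrib, ← Finset.mul_sum, Finset.sum_ite_eq', Finset.mem_univ,
      if_true]
    rw [hW]; ring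

theorem Good.mut {Bt : EM n} (h : Good Bt) (k : Fin n) : Good (extMut Bt k) where
  ts := by
    intro l; rw [sq_mut]; exact h.ts (k :: l)
  surj := by
    intro r
    obtain ⟨w, hw⟩ := h.surj (fun j => if j = k then -r k else
      r j + max (Bt (Sum.inl k) j) 0 * r k)
    refine ⟨wm Bt k w, fun j => ?_⟩
    rw [wm_sum _ _ (h.diag k), hw, hw]
    by_cases hj : j = k <;> simp [hj]

def U {K : Type} [Field K] (x : Fin n ⊕ Fin n → K) (Bt : EM n) (u : K) : Prop :=
  u ∈ LR x ∧ ∀ j, u ∈ LR (mu x (Sum.inl j) (col Bt j))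

theorem col_mut_self (Bt : EM n) (k : Fin n) : col (extMut Bt k) k = - col Bt k := by
  funext s; simp [col, extMut]

theorem U_mut {K : Type} [Field K] {x : Fin n ⊕ Fin n → K} (h : Indep x) {Bt : EM n}
    (hG : Good Bt) (k : Fin n) (u : K) (hu : U x Bt u) :
    U (mu x (Sum.inl k) (col Bt k)) (extMut Bt k) u := by
  refine ⟨hu.2 k, fun j => ?_⟩
  by_cases hjk : j = k
  · subst hjk
    rw [col_mut_self, mu_neg, mu_mu h _ _ (hG.diag j)]
    exact hu.1
  · obtain ⟨w, hw⟩ := hG.surj (Pi.single j 1)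
    let ω : (Fin n ⊕ Fin n → ℤ) →+ ℤ :=
      { toFun := fun e => ∑ s, w s * e s
        map_zero' := by simp
        map_add' := fun a b => by simp [mul_add, Finset.sum_add_distrib] }
    have hne : (Sum.inl j : Fin n ⊕ Fin n) ≠ Sum.inl k := fun h => hjk (Sum.inl.inj h)
    refine rank2 h (Sum.inl j) (Sum.inl k) hne (col Bt j) (col Bt k) _ (hG.diag j) (hG.diag k)
      (hG.sss k j) ?_ ?_ ω ?_ ?_ u hu.1 (hu.2 j) (hu.2 k)
    · simp [col, extMut]
    · intro s hs
      simp [col, extMut, hs, hjk, pp]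
    · exact (hw j).trans (by simp)
    · exact (hw k).trans (by simp [Ne.symm hjk])

theorem U_mut_iff {K : Type} [Field K] {x : Fin n ⊕ Fin n → K} (h : Indep x) {Bt : EM n}
    (hG : Good Bt) (k : Fin n) (u : K) :
    U (mu x (Sum.inl k) (col Bt k)) (extMut Bt k) u ↔ U x Bt u := by
  refine ⟨fun hu => ?_, U_mut h hG k u⟩
  have := U_mut (h.mu _ _ (hG.diag k)) (hG.mut k) k u hu
  rwa [col_mut_self, mu_neg, mu_mu h _ _ (hG.diag k), extMut_extMut] at this

/-- combined variables -/
noncomputable def cv (B : Matrix (Fin n) (Fin n) ℤ) (t : List (Fin n)) : Fin n ⊕ Fin n → CA.K n :=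
  Sum.elim (seed B t).x yv

theorem seed_B (B : Matrix (Fin n) (Fin n) ℤ) (t : List (Fin n)) : (seed B t).B = extBAt B t := by
  induction t using List.reverseRecOn with
  | nil => rfl
  | append_singleton t k ih =>
    simp only [seed, extBAt, List.foldl_append, List.foldl_cons, List.foldl_nil] at ih ⊢
    rw [← ih]; rfl

theorem extBAt_snoc (B : Matrix (Fin n) (Fin n) ℤ) (t : List (Fin n)) (k : Fin n) :
    extBAt B (t ++ [k]) = extMut (extBAt B t) k := by
  simp [extBAt]

theorem cv_snoc (B : Matrix (Fin n) (Fin n) ℤ) (t : List (Fin n)) (k : Fin n) :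
    cv B (t ++ [k]) = mu (cv B t) (Sum.inl k) (col (extBAt B t) k) := by
  have h1 : seed B (t ++ [k]) = mutSeed (seed B t) k := by simp [seed]
  funext s
  rcases s with i | i
  · by_cases hi : i = k
    · subst hi
      rw [mu_self, cv, h1]
      simp [mutSeed, EX, mono, cv, bp, bn, col, pp, seed_B]
    · rw [mu_of_ne _ _ (by simpa using hi), cv, h1]
      simp [mutSeed, cv, hi]
  · rw [mu_of_ne _ _ (by simp)]; rfl

theorem good_init {B : Matrix (Fin n) (Fin n) ℤ} (hB : TSSS B) : Good (extB B) where
  ts := hB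
  surj r := ⟨Sum.elim 0 r, fun j => by
    have : ∀ i, extB B (Sum.inr i) j = if i = j then 1 else 0 := fun i => rfl
    simp [this]⟩

theorem good_at {B : Matrix (Fin n) (Fin n) ℤ} (hB : TSSS B) (t : List (Fin n)) :
    Good (extBAt B t) := by
  induction t using List.reverseRecOn with
  | nil => exact good_init hB
  | append_singleton t k ih => rw [extBAt_snoc]; exact ih.mut k

theorem cv_nil (B : Matrix (Fin n) (Fin n) ℤ) : cv B [] = gen := by
  funext s; rcases s with i | i <;> rfl

theorem gen_ne (s : Fin n ⊕ Fin n) : (gen s : CA.K n) ≠ 0 := by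
  rw [gen]
  intro h
  exact MvPolynomial.X_ne_zero (R := ℚ) s
    ((IsFractionRing.injective (MvPolynomial (Fin n ⊕ Fin n) ℚ) (CA.K n)) (by rw [h, map_zero]))

noncomputable def Phi (σ : Type) : MvPolynomial σ ℤ →+* R σ :=
  MvPolynomial.eval₂Hom (Int.castRingHom _) (fun s => single (Pi.single s 1) 1)

theorem Phi_monomial {σ : Type} [Fintype σ] (m : σ →₀ ℕ) (c : ℤ) :
    Phi σ (MvPolynomial.monomial m c) = single (fun s => (m s : ℤ)) c := by
  rw [Phi, MvPolynomial.coe_eval₂Hom, MvPolynomial.eval₂_monomial,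
    Finsupp.prod_fintype _ _ (by simp)]
  have h1 : ∀ T : Finset σ, (∏ i ∈ T, (single (Pi.single i 1) 1 : R σ) ^ m i) =
      single (∑ i ∈ T, Pi.single i (m i : ℤ)) 1 := by
    intro T
    induction T using Finset.induction_on with
    | empty => simp [AddMonoidAlgebra.one_def]
    | insert a T ha ih =>
      rw [Finset.prod_insert ha, ih, Finset.sum_insert ha, single_pow, single_mul_single]
      congr 1
      · congr 1
        funext s
        by_cases h : s = a
        · subst h; simp
        · simp [h]
      · simp
  rw [h1, Finset.univ_sum_single]
  have h2 : (Int.castRingHom (R σ)) c = single 0 c := by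
    have h3 : (single 0 c : R σ) = c • single 0 1 := by rw [smul_single]; simp
    rw [h3, ← AddMonoidAlgebra.one_def]; simp
  rw [h2, single_mul_single]; simp

theorem Phi_clear {σ : Type} [Fintype σ] (f : R σ) :
    ∃ (m : σ →₀ ℕ) (p : MvPolynomial σ ℤ), Phi σ (MvPolynomial.monomial m 1) * f = Phi σ p := by
  induction f using R_induction with
  | h0 => exact ⟨0, 0, by simp⟩
  | hadd f g hf hg =>
    obtain ⟨m, p, h⟩ := hf
    obtain ⟨m', p', h'⟩ := hg
    refine ⟨m + m', MvPolynomial.monomial m' 1 * p + MvPolynomial.monomial m 1 * p', ?_⟩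
    have : MvPolynomial.monomial (m + m') (1:ℤ) =
      MvPolynomial.monomial m 1 * MvPolynomial.monomial m' 1 := by
      rw [MvPolynomial.monomial_mul, mul_one]
    rw [this, map_mul, map_add, map_mul, map_mul, ← h, ← h']; ring
  | hs e c =>
    refine ⟨Finsupp.equivFunOnFinite.symm fun s => (max (-e s) 0).toNat,
      MvPolynomial.monomial (Finsupp.equivFunOnFinite.symm fun s => (max (e s) 0).toNat) c, ?_⟩
    rw [Phi_monomial, Phi_monomial, single_mul_single, one_mul]
    congr 1
    funext s
    simp
    omega

theorem ev_Phi (p : MvPolynomial (Fin n ⊕ Fin n) ℤ) :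
    ev (gen : _ → CA.K n) gen_ne (Phi _ p) =
      algebraMap (MvPolynomial (Fin n ⊕ Fin n) ℚ) (CA.K n)
        (MvPolynomial.map (Int.castRingHom ℚ) p) := by
  have : (ev (gen : _ → CA.K n) gen_ne).comp (Phi _) =
      (algebraMap (MvPolynomial (Fin n ⊕ Fin n) ℚ) (CA.K n)).comp
        (MvPolynomial.map (Int.castRingHom ℚ)) := by
    apply MvPolynomial.ringHom_ext
    · intro r; simp
    · intro s
      simp [Phi, ev_single, mono_pi_single, gen]
  exact congrArg (fun g => g p) this

theorem indep_gen : Indep (gen : _ → CA.K n) := by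
  refine ⟨gen_ne, fun f hf => ?_⟩
  obtain ⟨m, p, h⟩ := Phi_clear f
  have h1 := congrArg (ev (gen : _ → CA.K n) gen_ne) h
  rw [map_mul, hf, mul_zero, ev_Phi] at h1
  have h2 : MvPolynomial.map (Int.castRingHom ℚ) p = 0 :=
    IsFractionRing.injective (MvPolynomial (Fin n ⊕ Fin n) ℚ) (CA.K n) (by rw [← h1, map_zero])
  have h3 : p = 0 := MvPolynomial.map_injective _ Int.cast_injective (by rw [h2, map_zero])
  rw [h3, map_zero, Phi_monomial] at h
  refine (mul_eq_zero.mp h).resolve_left ?_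
  intro h4
  have := congrArg (fun q => q.coeff (fun s => (m s : ℤ))) h4
  simp at this

theorem indep_at {B : Matrix (Fin n) (Fin n) ℤ} (hB : TSSS B) (t : List (Fin n)) :
    Indep (cv B t) := by
  induction t using List.reverseRecOn with
  | nil => rw [cv_nil]; exact indep_gen
  | append_singleton t k ih => rw [cv_snoc]; exact ih.mu _ _ ((good_at hB t).diag k)

theorem U_at_iff {B : Matrix (Fin n) (Fin n) ℤ} (hB : TSSS B) (t : List (Fin n)) (u : CA.K n) :
    U (cv B t) (extBAt B t) u ↔ U gen (extB B) u := by
  induction t using List.reverseRecOn with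
  | nil => rw [cv_nil]; rfl
  | append_singleton t k ih =>
    rw [cv_snoc, extBAt_snoc, U_mut_iff (indep_at hB t) (good_at hB t), ih]

theorem U_self {K : Type} [Field K] {x : Fin n ⊕ Fin n → K} (h : Indep x) {Bt : EM n}
    (hG : Good Bt) (s : Fin n ⊕ Fin n) : U x Bt (x s) :=
  ⟨LR_mem _ _, fun j => self_mem_mu h _ _ (hG.diag j) s⟩

theorem U_var {B : Matrix (Fin n) (Fin n) ℤ} (hB : TSSS B) (t : List (Fin n)) (l : Fin n) :
    U gen (extB B) ((seed B t).x l) :=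
  (U_at_iff hB t _).mp (U_self (indep_at hB t) (good_at hB t) (Sum.inl l))

end CAX

namespace CAX
open AddMonoidAlgebra CA
set_option linter.all false

variable {n : ℕ}

theorem ev_eq_sum {σ : Type} [Fintype σ] {K : Type} [Field K] (x : σ → K) (hx : ∀ s, x s ≠ 0)
    (f : R σ) : ev x hx f = f.coeff.sum (fun e c => (c : K) * mono x e) := by
  induction f using R_induction with
  | h0 => simp
  | hadd f g hf hg =>
    rw [map_add, hf, hg, coeff_add, Finsupp.sum_add_index']
    · intro e; simp
    · intro e a b; push_cast; ring
  | hs e c => rw [ev_single, coeff_single, Finsupp.sum_single_index]; simp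

theorem yhat_ne (B : Matrix (Fin n) (Fin n) ℤ) (j : Fin n) : yhat B j ≠ 0 :=
  mul_ne_zero (gen_ne _) (Finset.prod_ne_zero_iff.mpr fun i _ => zpow_ne_zero _ (gen_ne _))

noncomputable def tv (B : Matrix (Fin n) (Fin n) ℤ) : Fin n ⊕ Fin n → CA.K n :=
  Sum.elim 1 (yhat B)

theorem tv_ne (B : Matrix (Fin n) (Fin n) ℤ) (s : Fin n ⊕ Fin n) : tv B s ≠ 0 := by
  rcases s with i | i
  · simp [tv]
  · exact yhat_ne B i

/-- homogeneous components map -/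
noncomputable def th (B : Matrix (Fin n) (Fin n) ℤ) : R (Fin n ⊕ Fin n) →+* CA.K n :=
  ev (tv B) (tv_ne B)

theorem xv_ne (i : Fin n) : (xv i : CA.K n) ≠ 0 := gen_ne _

theorem th_FPoly (B : Matrix (Fin n) (Fin n) ℤ) (f : LP n) :
    th B (ofCoeff f) = (FPoly f).sum fun p c => (c : CA.K n) * mono (yhat B) p := by
  rw [th, ev_eq_sum, FPoly, Finsupp.sum_mapDomain_index]
  · apply Finsupp.sum_congr
    intro e _
    simp [mono, tv]
  · intro e; simp
  · intro e a b; push_cast; ring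

theorem evalAt_nil (B : Matrix (Fin n) (Fin n) ℤ) (f : LP n) :
    evalAt B [] f = ev (gen : _ → CA.K n) gen_ne (ofCoeff f) := by
  rw [ev_eq_sum, evalAt]
  apply Finsupp.sum_congr
  intro e _
  have h1 : ∀ i, yvarAt B [] i = yv i := by
    intro i
    rw [yvarAt, Finset.prod_eq_single i]
    · have : extBAt B [] (Sum.inr i) i = 1 := by
        show (if i = i then (1:ℤ) else 0) = 1
        simp
      rw [this, zpow_one]
    · intro b _ hb
      have : extBAt B [] (Sum.inr b) i = 0 := by
        show (if b = i then (1:ℤ) else 0) = 0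
        simp [hb]
      rw [this, zpow_zero]
    · simp
  have h2 : (seed B []).x = xv := rfl
  simp only [h1, h2, mono, Fintype.prod_sum_type]
  change _ * (∏ i, yv i ^ _) * (∏ i, xv i ^ _) = _ * ((∏ i, xv i ^ _) * ∏ i, yv i ^ _)
  ring

structure HomData (B : Matrix (Fin n) (Fin n) ℤ) (t : List (Fin n))
    (G : Fin n ⊕ Fin n → Fin n → ℤ) (r : Fin n ⊕ Fin n → R (Fin n ⊕ Fin n)) : Prop where
  ex : ∀ s, ev gen gen_ne (r s) = cv B t s
  hm : ∀ s, cv B t s = mono xv (G s) * th B (r s)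
  bal : ∀ i j, ∑ s, G s i * extBAt B t s j = 0

theorem mono_prod {ι : Type} {K : Type} [Field K] {x : Fin n → K} (hx : ∀ s, x s ≠ 0)
    (T : Finset ι) (F : ι → Fin n → ℤ) : mono x (∑ s ∈ T, F s) = ∏ s ∈ T, mono x (F s) := by
  induction T using Finset.induction_on with
  | empty => simp [mono_zero]
  | insert a T ha ih => rw [Finset.sum_insert ha, Finset.prod_insert ha, mono_add hx, ih]

theorem HomData.pow {B : Matrix (Fin n) (Fin n) ℤ} {t : List (Fin n)} {G r}
    (h : HomData B t G r) (e : Fin n ⊕ Fin n → ℤ) (he : ∀ s, 0 ≤ e s) :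
    ev gen gen_ne (∏ s, r s ^ (e s).toNat) = mono (cv B t) e ∧
    mono (cv B t) e = mono xv (∑ s, e s • G s) * th B (∏ s, r s ^ (e s).toNat) := by
  constructor
  · rw [map_prod, mono]
    apply Finset.prod_congr rfl
    intro s _
    rw [map_pow, h.ex, ← zpow_natCast, Int.toNat_of_nonneg (he s)]
  · rw [map_prod, mono_prod xv_ne, ← Finset.prod_mul_distrib, mono]
    apply Finset.prod_congr rfl
    intro s _
    rw [mono_nsmul, map_pow, h.hm, mul_zpow, ← zpow_natCast, Int.toNat_of_nonneg (he s)]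

theorem homData_nil (B : Matrix (Fin n) (Fin n) ℤ) :
    ∃ G r, HomData B [] G r := by
  refine ⟨Sum.elim (fun l => Pi.single l 1) (fun m => -(fun i => B i m)),
    fun s => single (Pi.single s 1) 1, ?_, ?_, ?_⟩
  · intro s; rw [ev_single, mono_pi_single', cv_nil]; simp
  · intro s
    rw [th, ev_single, mono_pi_single', cv_nil]
    rcases s with l | m
    · simp [mono_pi_single', tv]; rfl
    · simp only [Sum.elim_inr, tv]
      rw [mono_neg, yhat]
      have h0 : mono xv (fun i => B i m) ≠ (0 : CA.K n) := mono_ne xv_ne _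
      simp only [mono] at h0 ⊢
      rw [Int.cast_one, one_mul, zpow_one, mul_comm (yv m), inv_mul_cancel_left₀ h0]; rfl
  · intro i j
    have h1 : ∀ m, extBAt B [] (Sum.inr m) j = if m = j then 1 else 0 := fun _ => rfl
    have h2 : ∀ m, extBAt B [] (Sum.inl m) j = B m j := fun _ => rfl
    simp [Fintype.sum_sum_type, h1, h2, Pi.single_apply]

theorem homData {B : Matrix (Fin n) (Fin n) ℤ} (hB : TSSS B) (t : List (Fin n)) :
    ∃ G r, HomData B t G r := by
  induction t using List.reverseRecOn with
  | nil => exact homData_nil B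
  | append_singleton t k ih =>
    obtain ⟨G, r, h⟩ := ih
    have hU := (U_var hB (t ++ [k]) k).1
    rw [mem_LR_iff _ gen_ne] at hU
    obtain ⟨rk, hrk⟩ := hU
    have hrk' : ev gen gen_ne rk = cv B (t ++ [k]) (Sum.inl k) := hrk
    set Bt := extBAt B t with hBt
    set b := col Bt k with hb
    have hI := indep_at hB t
    obtain ⟨p1, p2⟩ := h.pow (bp b) (fun s => le_max_right _ _)
    obtain ⟨q1, q2⟩ := h.pow (bn b) (fun s => le_max_right _ _)
    set RP := ∏ s, r s ^ (bp b s).toNat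
    set RQ := ∏ s, r s ^ (bn b s).toNat
    have hbal : ∑ s, bp b s • G s = ∑ s, bn b s • G s := by
      rw [← sub_eq_zero, ← Finset.sum_sub_distrib]
      funext i
      rw [Finset.sum_apply]
      simp only [← sub_smul, bp_eq, Pi.add_apply, add_sub_cancel_left, Pi.smul_apply, smul_eq_mul]
      refine Eq.trans ?_ (h.bal i k)
      exact Finset.sum_congr rfl fun s _ => mul_comm _ _
    have hex : cv B (t ++ [k]) (Sum.inl k) * cv B t (Sum.inl k) =
        mono (cv B t) (bp b) + mono (cv B t) (bn b) := by
      rw [cv_snoc, mu_self, div_mul_cancel₀ _ (hI.ne _)]; rfl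
    have hR : rk * r (Sum.inl k) = RP + RQ := by
      apply indep_gen.inj'
      rw [map_mul, map_add, hrk', h.ex, p1, q1, hex]
    have hθ := congrArg (th B) hR
    rw [map_mul, map_add] at hθ
    set D := ∑ s, bn b s • G s with hD
    have hk0 : cv B t (Sum.inl k) ≠ 0 := hI.ne _
    have hnew : cv B (t ++ [k]) (Sum.inl k) = mono xv (D - G (Sum.inl k)) * th B rk := by
      apply mul_right_cancel₀ hk0
      rw [hex, p2, q2, hbal, ← mul_add, ← hθ, h.hm, sub_eq_add_neg, mono_add xv_ne, mono_neg]
      have := mono_ne (x := (xv : Fin n → CA.K n)) xv_ne (G (Sum.inl k))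
      field_simp
    refine ⟨Function.update G (Sum.inl k) (D - G (Sum.inl k)), Function.update r (Sum.inl k) rk,
      ?_, ?_, ?_⟩
    · intro s
      by_cases hs : s = Sum.inl k
      · subst hs; simpa using hrk'
      · rw [Function.update_of_ne hs, h.ex, cv_snoc, mu_of_ne _ _ hs]
    · intro s
      by_cases hs : s = Sum.inl k
      · subst hs; simpa using hnew
      · rw [Function.update_of_ne hs, Function.update_of_ne hs, ← h.hm, cv_snoc, mu_of_ne _ _ hs]
    · intro i j
      have hw := wm_sum Bt k ((good_at hB t).diag k) (fun s => G s i) j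
      rw [h.bal, h.bal] at hw
      rw [extBAt_snoc, ← hBt]
      have e : ∀ s, Function.update G (Sum.inl k) (D - G (Sum.inl k)) s i =
          wm Bt k (fun s => G s i) s := by
        intro s
        by_cases hs : s = Sum.inl k
        · subst hs
          simp only [wm, Function.update_self, hD, Pi.sub_apply, Finset.sum_apply, Pi.smul_apply,
            smul_eq_mul, bn, hb, col]
          ring
        · simp [wm, hs]
      simp only [e]
      rw [hw]; simp

theorem homog {B : Matrix (Fin n) (Fin n) ℤ} (hB : TSSS B) (t : List (Fin n)) (l : Fin n)
    (f : LP n) (hf : IsExp B t l f) : ∃ g : Fin n → ℤ,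
    (seed B t).x l = mono xv g * (FPoly f).sum fun p c => (c : CA.K n) * mono (yhat B) p := by
  obtain ⟨G, r, h⟩ := homData hB t
  refine ⟨G (Sum.inl l), ?_⟩
  rw [← th_FPoly]
  have : r (Sum.inl l) = ofCoeff f := by
    apply indep_gen.inj'
    rw [h.ex, ← evalAt_nil B]
    exact hf
  rw [← this, ← h.hm]; rfl

end CAX

namespace CAX
open AddMonoidAlgebra CA
set_option linter.all false

variable {n : ℕ}

noncomputable def pt (j : Fin n) : Fin n ⊕ Fin n → ℚ := fun s => if s = Sum.inr j then 0 else 1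

noncomputable abbrev al (n : ℕ) : MvPolynomial (Fin n ⊕ Fin n) ℚ →+* CA.K n := algebraMap _ _

def SP (j : Fin n) (z : CA.K n) : Prop := ∃ p q : MvPolynomial (Fin n ⊕ Fin n) ℚ,
  0 < MvPolynomial.eval (pt j) p ∧ 0 < MvPolynomial.eval (pt j) q ∧ z = al n p / al n q

def SN (j : Fin n) (z : CA.K n) : Prop := ∃ p q : MvPolynomial (Fin n ⊕ Fin n) ℚ,
  0 ≤ MvPolynomial.eval (pt j) p ∧ 0 < MvPolynomial.eval (pt j) q ∧ z = al n p / al n q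

theorem al_ne {j : Fin n} {q : MvPolynomial (Fin n ⊕ Fin n) ℚ}
    (h : 0 < MvPolynomial.eval (pt j) q) : al n q ≠ 0 := by
  intro h0
  have : q = 0 := IsFractionRing.injective (MvPolynomial (Fin n ⊕ Fin n) ℚ) (CA.K n)
    (by rw [map_zero]; exact h0)
  rw [this, map_zero] at h
  exact lt_irrefl _ h

theorem SP.toSN {j : Fin n} {z : CA.K n} (h : SP j z) : SN j z := by
  obtain ⟨p, q, hp, hq, e⟩ := h; exact ⟨p, q, hp.le, hq, e⟩

theorem SP.mul {j : Fin n} {z w : CA.K n} (h : SP j z) (h' : SP j w) : SP j (z * w) := by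
  obtain ⟨p, q, hp, hq, rfl⟩ := h
  obtain ⟨p', q', hp', hq', rfl⟩ := h'
  refine ⟨p * p', q * q', ?_, ?_, ?_⟩
  · rw [map_mul]; positivity
  · rw [map_mul]; positivity
  · rw [map_mul, map_mul, div_mul_div_comm]

theorem SN.mul {j : Fin n} {z w : CA.K n} (h : SN j z) (h' : SN j w) : SN j (z * w) := by
  obtain ⟨p, q, hp, hq, rfl⟩ := h
  obtain ⟨p', q', hp', hq', rfl⟩ := h'
  refine ⟨p * p', q * q', ?_, ?_, ?_⟩
  · rw [map_mul]; positivity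
  · rw [map_mul]; positivity
  · rw [map_mul, map_mul, div_mul_div_comm]

theorem SP.inv {j : Fin n} {z : CA.K n} (h : SP j z) : SP j z⁻¹ := by
  obtain ⟨p, q, hp, hq, rfl⟩ := h
  exact ⟨q, p, hq, hp, by rw [inv_div]⟩

theorem SP.add {j : Fin n} {z w : CA.K n} (h : SP j z) (h' : SN j w) : SP j (z + w) := by
  obtain ⟨p, q, hp, hq, rfl⟩ := h
  obtain ⟨p', q', hp', hq', rfl⟩ := h'
  refine ⟨p * q' + q * p', q * q', ?_, ?_, ?_⟩
  · rw [map_add, map_mul, map_mul]; positivity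
  · rw [map_mul]; positivity
  · rw [map_add, map_mul, map_mul, map_mul, div_add_div _ _ (al_ne hq) (al_ne hq')]

theorem SP.one (j : Fin n) : SP j 1 := ⟨1, 1, by simp, by simp, by simp⟩

theorem SP.npow {j : Fin n} {z : CA.K n} (h : SP j z) (m : ℕ) : SP j (z ^ m) := by
  induction m with
  | zero => simpa using SP.one j
  | succ m ih => rw [pow_succ]; exact ih.mul h

theorem SN.npow {j : Fin n} {z : CA.K n} (h : SN j z) (m : ℕ) : SN j (z ^ m) := by
  induction m with
  | zero => simpa using (SP.one j).toSN
  | succ m ih => rw [pow_succ]; exact ih.mul h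

theorem SP.zpow {j : Fin n} {z : CA.K n} (h : SP j z) (m : ℤ) : SP j (z ^ m) := by
  obtain ⟨k, rfl | rfl⟩ := m.eq_nat_or_neg
  · rw [zpow_natCast]; exact h.npow k
  · rw [zpow_neg, zpow_natCast]; exact (h.npow k).inv

theorem SP.gen {j : Fin n} {s : Fin n ⊕ Fin n} (hs : s ≠ Sum.inr j) : SP j (gen s) :=
  ⟨MvPolynomial.X s, 1, by simp [pt, hs], by simp, by simp [CA.gen]⟩

theorem SN.gen {j : Fin n} (s : Fin n ⊕ Fin n) : SN j (CA.gen s) :=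
  ⟨MvPolynomial.X s, 1, by simp only [MvPolynomial.eval_X, pt]; split_ifs <;> norm_num, by simp,
    by simp [CA.gen]⟩

theorem SP.mono {j : Fin n} {x : Fin n ⊕ Fin n → CA.K n} (hx : ∀ s, s ≠ Sum.inr j → SP j (x s))
    (e : Fin n ⊕ Fin n → ℤ) (he : e (Sum.inr j) = 0) : SP j (mono x e) := by
  apply Finset.prod_induction _ (SP j) (fun a b ha hb => ha.mul hb) (SP.one j)
  intro s _
  by_cases hs : s = Sum.inr j
  · rw [hs, he, zpow_zero]; exact SP.one j
  · exact (hx s hs).zpow _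

theorem SN.mono {j : Fin n} {x : Fin n ⊕ Fin n → CA.K n} (hx : ∀ s, s ≠ Sum.inr j → SP j (x s))
    (hj : SN j (x (Sum.inr j)))
    (e : Fin n ⊕ Fin n → ℤ) (he : 0 ≤ e (Sum.inr j)) : SN j (mono x e) := by
  apply Finset.prod_induction _ (SN j) (fun a b ha hb => ha.mul hb) (SP.one j).toSN
  intro s _
  by_cases hs : s = Sum.inr j
  · rw [hs, ← Int.toNat_of_nonneg he, zpow_natCast]; exact hj.npow _
  · exact ((hx s hs).zpow _).toSN

theorem SP_at (B : Matrix (Fin n) (Fin n) ℤ) (j : Fin n) (t : List (Fin n)) :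
    ∀ s, s ≠ Sum.inr j → SP j (cv B t s) := by
  induction t using List.reverseRecOn with
  | nil => intro s hs; rw [cv_nil]; exact SP.gen hs
  | append_singleton t k ih =>
    intro s hs
    rw [cv_snoc]
    by_cases hk : s = Sum.inl k
    · subst hk
      rw [mu_self, div_eq_mul_inv]
      refine SP.mul ?_ (ih _ hs).inv
      have hy : SN j (cv B t (Sum.inr j)) := SN.gen (Sum.inr j)
      set b := col (extBAt B t) k
      rcases le_total (b (Sum.inr j)) 0 with h | h
      · exact (SP.mono ih _ (by simp only [bp]; omega)).add (SN.mono ih hy _ (le_max_right _ _))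
      · rw [EX, add_comm]
        exact (SP.mono ih _ (by simp only [bn]; omega)).add (SN.mono ih hy _ (le_max_right _ _))
    · rw [mu_of_ne _ _ hk]; exact ih s hs

theorem not_SP (j : Fin n) (P : MvPolynomial (Fin n ⊕ Fin n) ℚ)
    (hP : MvPolynomial.eval (pt j) P ≤ 0) : ¬ SP j (al n P) := by
  rintro ⟨p, q, hp, hq, h⟩
  rw [eq_div_iff (al_ne hq), ← map_mul] at h
  have h2 : P * q = p := IsFractionRing.injective (MvPolynomial (Fin n ⊕ Fin n) ℚ) (CA.K n) h
  rw [← h2, map_mul] at hp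
  nlinarith

theorem pos_final {B : Matrix (Fin n) (Fin n) ℤ} (t : List (Fin n)) (l k : Fin n)
    (ε : ℤ) (hε : ε = 1 ∨ ε = -1) (c : Fin n → ℤ)
    (h : xv k = (ε : CA.K n) * (seed B t).x l * mono yv c) : (seed B t).x l = xv k := by
  have hxs : ∀ j, SP j ((seed B t).x l) := fun j => SP_at B j t (Sum.inl l) (by simp)
  have hxk : ∀ j : Fin n, SP j (xv k) := fun j => SP.gen (by simp)
  have hx0 : (seed B t).x l ≠ 0 := by
    intro h0; rw [h0, mul_zero, zero_mul] at h; exact gen_ne _ h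
  have hq : ∀ j, SP j ((ε : CA.K n) * mono yv c) := by
    intro j
    have := (hxk j).mul (hxs j).inv
    rw [h] at this
    convert this using 1
    field_simp
  have hc : c = 0 := by
    funext j
    have h1 : mono (yv : Fin n → CA.K n) c = mono yv (Function.update c j 0) * yv j ^ c j :=
      mono_split' _ _ _
    have h2 : SP j (mono (yv : Fin n → CA.K n) (Function.update c j 0)) := by
      apply Finset.prod_induction _ (SP j) (fun a b ha hb => ha.mul hb) (SP.one j)
      intro s _
      by_cases hs : s = j
      · rw [hs]; simpa using SP.one j
      · refine (SP.gen ?_).zpow _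
        simpa using hs
    have h20 : mono (yv : Fin n → CA.K n) (Function.update c j 0) ≠ 0 :=
      mono_ne (fun s => gen_ne _) _
    have h3 : SP j ((ε : CA.K n) * yv j ^ c j) := by
      have := (hq j).mul h2.inv
      rw [h1] at this
      convert this using 1
      field_simp
    have h4 : ∀ m : ℕ, 0 < m → ¬ SP j ((ε : CA.K n) * yv j ^ m) := by
      intro m hm
      have : (ε : CA.K n) * yv j ^ m = al n ((ε : MvPolynomial _ ℚ) *
          MvPolynomial.X (Sum.inr j) ^ m) := by
        simp [yv, CA.gen]
      rw [this]
      apply not_SP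
      simp [pt, hm.ne']
    rcases lt_trichotomy (c j) 0 with h5 | h5 | h5
    · exfalso
      apply h4 (-c j).toNat (by omega)
      have := h3.inv
      rw [mul_inv, ← zpow_neg] at this
      have e : (ε : CA.K n)⁻¹ = ε := by rcases hε with rfl | rfl <;> simp
      rwa [e, ← Int.toNat_of_nonneg (show 0 ≤ -c j by omega), zpow_natCast] at this
    · exact h5
    · exfalso
      apply h4 (c j).toNat (by omega)
      rwa [← Int.toNat_of_nonneg (show 0 ≤ c j by omega), zpow_natCast] at h3
  rw [hc, mono_zero, mul_one] at h hq
  rcases hε with rfl | rfl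
  · rw [h]; simp
  · exfalso
    apply not_SP k (-1) (by simp)
    simpa using hq k

end CAX

namespace CAX
open AddMonoidAlgebra CA
set_option linter.all false

variable {n : ℕ}

theorem single_eq {σ : Type} {a b : σ → ℤ} {c d : ℤ} (hc : c ≠ 0)
    (h : (single a c : R σ) = single b d) : a = b := by
  have h1 := congrArg (fun q => q.coeff a) h
  simp only [coeff_single, Finsupp.single_eq_same] at h1
  by_contra hab
  rw [Finsupp.single_eq_of_ne hab] at h1
  exact hc h1

theorem PR_not_unit {σ : Type} [Fintype σ] (b : σ → ℤ) (hb : b ≠ 0) (f : R σ)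
    (h : PR b * f = 1) : False := by
  rw [AddMonoidAlgebra.one_def] at h
  obtain ⟨a, ε, -, h1⟩ := unit_single _ _ _ h
  have hne : bp b ≠ bn b := by
    intro h2
    rw [bp_eq] at h2
    exact hb (add_eq_left.mp h2)
  have e1 := congrArg (fun q => q.coeff (bp b)) h1
  have e2 := congrArg (fun q => q.coeff (bn b)) h1
  simp only [PR, coeff_add, coeff_single, Finsupp.add_apply, Finsupp.single_eq_same,
    Finsupp.single_eq_of_ne hne, Finsupp.single_eq_of_ne hne.symm] at e1 e2
  have a1 : bp b = a := by
    by_contra hh; rw [Finsupp.single_eq_of_ne hh] at e1; simp at e1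
  have a2 : bn b = a := by
    by_contra hh; rw [Finsupp.single_eq_of_ne hh] at e2; simp at e2
  exact hne (a1.trans a2.symm)

theorem exp_nonneg {σ : Type} [Fintype σ] {K : Type} [Field K] {x : σ → K} (h : Indep x) (j : σ)
    (b : σ → ℤ) (hb : b j = 0) (hb0 : b ≠ 0) (a : σ → ℤ) (ε : ℤ) (hε : ε = 1 ∨ ε = -1)
    (hu : (ε : K) * mono x a ∈ LR (mu x j b)) : 0 ≤ a j := by
  by_contra hneg
  push Not at hneg
  have hz := h.mu j b hb
  set z := mu x j b with hzd
  have hP := EX_ne h b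
  obtain ⟨m, hm⟩ : ∃ m : ℕ, a j = -((m : ℤ) + 1) := ⟨(-a j - 1).toNat, by omega⟩
  have hPz : ev z hz.ne (PR b) = EX x b := by
    rw [ev_PR, hzd, mu, EX_update _ _ _ _ hb]
  have h1 : mono z (Function.update a j (m + 1)) = mono x a * EX x b ^ (m + 1) := by
    rw [hzd, mu, mono_update, mono_split' x j a, hm]
    simp only [Function.update_idem, Function.update_self]
    have := h.ne j
    rw [zpow_neg, div_zpow]
    have e : ((m : ℤ) + 1) = ((m + 1 : ℕ) : ℤ) := by push_cast; rfl
    rw [e, zpow_natCast, zpow_natCast]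
    field_simp
  have hmem : (EX x b)⁻¹ ∈ LR z := by
    have e : (EX x b)⁻¹ = ((ε : K) * mono x a) * ((ε : K) * EX x b ^ m *
        mono z (-(Function.update a j (m + 1)))) := by
      rw [mono_neg, h1]
      have := mono_ne h.ne a
      have e2 : (ε : K) * ε = 1 := by rcases hε with rfl | rfl <;> simp
      have e3 : (ε : K) ≠ 0 := by
        intro h0; rw [h0] at e2; simp at e2
      rw [pow_succ]
      have := pow_ne_zero m hP
      field_simp
      rw [pow_two, e2]
    rw [e]
    refine Subring.mul_mem _ hu (Subring.mul_mem _ (Subring.mul_mem _ (intCast_mem _ _)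
      (Subring.pow_mem _ ?_ _)) (LR_mono _ _))
    exact EX_mem_mu x j b hb
  rw [mem_LR_iff z hz.ne] at hmem
  obtain ⟨f, hf⟩ := hmem
  apply PR_not_unit b hb0 f
  apply hz.inj'
  rw [map_mul, hf, hPz, map_one, mul_inv_cancel₀ hP]

theorem Good.col_ne {Bt : EM n} (h : Good Bt) (j : Fin n) : col Bt j ≠ 0 := by
  intro h0
  obtain ⟨w, hw⟩ := h.surj (fun _ => 1)
  have h1 := hw j
  have h2 : ∀ s, Bt s j = 0 := fun s => congrFun h0 s
  simp [h2] at h1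

theorem main_contra {B : Matrix (Fin n) (Fin n) ℤ} (hB : TSSS B) (t t' : List (Fin n))
    (l l' : Fin n) (hni : NonInit B t l) (g : Fin n → ℤ)
    (h : (seed B t).x l = mono xv g * (seed B t').x l') (k : Fin n) (hk : 0 < g k) : False := by
  set x := (seed B t).x l with hx
  set x' := (seed B t').x l' with hx'
  have hxU := U_var hB t l
  have hxU' := U_var hB t' l'
  rw [← hx] at hxU
  rw [← hx'] at hxU'
  have hG := good_init hB
  have hxk0 : (xv k : CA.K n) ≠ 0 := xv_ne k
  have huU : U gen (extB B) (x * (xv k)⁻¹) := by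
    constructor
    · exact Subring.mul_mem _ hxU.1 (LR_mem_inv gen (Sum.inl k))
    · intro j
      by_cases hj : j = k
      · subst hj
        have e : x * (xv j)⁻¹ = mono xv (g - Pi.single j 1) * x' := by
          rw [h, sub_eq_add_neg, mono_add xv_ne, mono_neg, mono_pi_single']
          simp; ring
        rw [e]
        refine Subring.mul_mem _ ?_ (hxU'.2 j)
        apply mono_mem
        · intro s _
          exact self_mem_mu indep_gen _ _ (hG.diag j) (Sum.inl s)
        · intro s hs
          have hsj : s ≠ j := by
            rintro rfl; simp at hs; omega
          have := LR_mem_inv (mu (gen : _ → CA.K n) (Sum.inl j) (col (extB B) j)) (Sum.inl s)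
          rwa [mu_of_ne _ _ (by simpa using hsj)] at this
      · refine Subring.mul_mem _ (hxU.2 j) ?_
        have := LR_mem_inv (mu (gen : _ → CA.K n) (Sum.inl j) (col (extB B) j)) (Sum.inl k)
        rwa [mu_of_ne _ _ (by simpa using Ne.symm hj)] at this
  have hkU : U gen (extB B) (xv k) := U_self indep_gen hG (Sum.inl k)
  have hI := indep_at hB t
  have hGt := good_at hB t
  have huT := (U_at_iff hB t _).mpr huU
  have hkT := (U_at_iff hB t _).mpr hkU
  obtain ⟨fu, hfu⟩ := (mem_LR_iff _ hI.ne _).mp huT.1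
  obtain ⟨fk, hfk⟩ := (mem_LR_iff _ hI.ne _).mp hkT.1
  have hprod : fk * fu = single (Pi.single (Sum.inl l) 1) 1 := by
    apply hI.inj'
    rw [map_mul, hfu, hfk, ev_single, mono_pi_single']
    have : cv B t (Sum.inl l) = x := rfl
    rw [this]; field_simp; simp
  obtain ⟨a, ε, hε, ha⟩ := unit_single _ _ _ hprod
  obtain ⟨a', ε', hε', ha'⟩ := unit_single fu fk _ (by rw [mul_comm]; exact hprod)
  have hε0 : ε ≠ 0 := by rcases hε with rfl | rfl <;> simp
  have hε0' : ε' ≠ 0 := by rcases hε' with rfl | rfl <;> simp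
  rw [ha, ha', single_mul_single] at hprod
  have hsum := single_eq (mul_ne_zero hε0 hε0') hprod
  rw [ha, ev_single] at hfk
  rw [ha', ev_single] at hfu
  have hpos : ∀ j, 0 ≤ a (Sum.inl j) := fun j =>
    exp_nonneg hI (Sum.inl j) _ (hGt.diag j) (hGt.col_ne j) a ε hε (by rw [hfk]; exact hkT.2 j)
  have hpos' : ∀ j, 0 ≤ a' (Sum.inl j) := fun j =>
    exp_nonneg hI (Sum.inl j) _ (hGt.diag j) (hGt.col_ne j) a' ε' hε' (by rw [hfu]; exact huT.2 j)
  have hz : ∀ j, j ≠ l → a (Sum.inl j) = 0 := by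
    intro j hj
    have h1 := congrFun hsum (Sum.inl j)
    rw [Pi.add_apply, Pi.single_eq_of_ne (by simpa using hj)] at h1
    have := hpos j; have := hpos' j; omega
  have hl := congrFun hsum (Sum.inl l)
  rw [Pi.add_apply, Pi.single_eq_same] at hl
  have hp1 := hpos l
  have hp2 := hpos' l
  have hy : ∀ i, cv B t (Sum.inr i) = yv i := fun _ => rfl
  rcases (show a (Sum.inl l) = 0 ∨ a (Sum.inl l) = 1 by omega) with h0 | h1
  · have hz' : ∀ j, a (Sum.inl j) = 0 := fun j => by
      by_cases hj : j = l
      · rw [hj, h0]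
      · exact hz j hj
    have hg : mono (cv B t) a = mono gen a := by
      simp only [mono, Fintype.prod_sum_type, hz', zpow_zero, hy]; rfl
    have h2 : (single (Pi.single (Sum.inl k) 1) 1 : R (Fin n ⊕ Fin n)) = single a ε := by
      apply indep_gen.inj'
      rw [ev_single, ev_single, mono_pi_single', ← hg, hfk, zpow_one, Int.cast_one, one_mul]; rfl
    have h3 := congrFun (single_eq one_ne_zero h2) (Sum.inl k)
    rw [hz' k] at h3
    simp at h3
  · have hg : mono (cv B t) a = x * mono yv (fun i => a (Sum.inr i)) := by
      simp only [mono, Fintype.prod_sum_type, hy]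
      congr 1
      rw [Finset.prod_eq_single l]
      · rw [h1, zpow_one]; rfl
      · intro j _ hj; rw [hz j hj, zpow_zero]
      · simp
    refine hni k (pos_final t l k ε hε (fun i => a (Sum.inr i)) ?_)
    rw [← hfk, hg, mul_assoc]

theorem final {B : Matrix (Fin n) (Fin n) ℤ} (hB : TSSS B)
    (l l' : Fin n) (t t' : List (Fin n)) (f f' : LP n)
    (hf : IsExp B t l f) (hf' : IsExp B t' l' f')
    (hni : NonInit B t l) (hni' : NonInit B t' l')
    (hF : FPoly f = FPoly f') :
    (seed B t).x l = (seed B t').x l' := by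
  obtain ⟨g, hg⟩ := homog hB t l f hf
  obtain ⟨g', hg'⟩ := homog hB t' l' f' hf'
  rw [hF] at hg
  have key : ∀ (g g' : Fin n → ℤ) (z : CA.K n),
      mono xv g * z = mono xv (g - g') * (mono xv g' * z) := by
    intro g g' z
    rw [← mul_assoc, ← mono_add xv_ne, sub_add_cancel]
  have e1 : (seed B t).x l = mono xv (g - g') * (seed B t').x l' := by
    rw [hg, hg']; exact key _ _ _
  have e2 : (seed B t').x l' = mono xv (g' - g) * (seed B t).x l := by
    rw [hg, hg']; exact key _ _ _
  have hgg : g = g' := by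
    funext k
    rcases lt_trichotomy (g k) (g' k) with h | h | h
    · exact (main_contra hB t' t l' l hni' _ e2 k (by simpa using h)).elim
    · exact h
    · exact (main_contra hB t t' l l' hni _ e1 k (by simpa using h)).elim
  rw [hg, hg', hgg]

end CAX

namespace CA

/-- Corollary `$F$-polynomial uniquely determines cluster variable`.
Let `𝒜` be a TSSS cluster algebra having principal coefficients at `t₀` and let
`x_{l;t}`, `x_{l';t'}` be non-initial cluster variables with Laurent expansions `f`, `f'`
in the initial cluster and `F`-polynomials `F_{l;t} = FPoly f`, `F_{l';t'} = FPoly f'`.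
If `F_{l;t} = F_{l';t'}` then `x_{l;t} = x_{l';t'}`. -/
theorem statement13 {n : ℕ} (B : Matrix (Fin n) (Fin n) ℤ) (hB : TSSS B)
    (l l' : Fin n) (t t' : List (Fin n)) (f f' : LP n)
    (hf : IsExp B t l f) (hf' : IsExp B t' l' f')
    (hni : NonInit B t l) (hni' : NonInit B t' l')
    (hF : FPoly f = FPoly f') :
    (seed B t).x l = (seed B t').x l' := by
  exact CAX.final hB l l' t t' f f' hf hf' hni hni' hF

end CA
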